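/- arXiv:0801.3626 — 6 statements merged into one kernel-verified Lean document; each statement's English description precedes it below -/
import Mathlib

section
/- Let k be a field, L a finite simplicial complex on vertex set V, and let z, z' be two elements of the degree-one piece k⟨L⟩¹ of the exterior Stanley–Reisner ring of L. If supp(z) = supp(z'), then β_i(k⟨L⟩, z) = β_i(k⟨L⟩, z') for all i ≥ 1. -/
open Finset

variable {V : Type} [Fintype V] [LinearOrder V]

/-- The set of faces of cardinality `c` of a finite family of finsets `L`
(for a simplicial complex, these index the `(c-1)`-simplices, with the empty
simplex corresponding to `c = 0`). -/
abbrev Face (L : Finset (Finset V)) (c : ℕ) := {σ : Finset V // σ ∈ L ∧ σ.card = c}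

/-- `L` is (the face set of) a finite abstract simplicial complex:  it contains the
empty face and is closed under passing to subsets. -/
def IsCx (L : Finset (Finset V)) : Prop :=
  ∅ ∈ L ∧ ∀ σ ∈ L, ∀ τ ⊆ σ, τ ∈ L

/-- Incidence coefficient between a face `τ` and a face `σ` (intended: `τ ⊆ σ` with
`|σ| = |τ| + 1`), twisted by the weights `z`:  if `σ = τ ∪ {v}` this is
`(-1)^{#{w ∈ τ : w < v}} ⬝ z v`, and `0` if `τ ⊄ σ`. -/
def coeffD {R : Type} [CommRing R] (z : V → R) (τ σ : Finset V) : R :=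
  if τ ⊆ σ then ∑ v ∈ σ \ τ, (-1 : R) ^ (τ.filter (fun w => w < v)).card * z v else 0

/-- The boundary map `∂^z : C_{c+1}(T_L, R_z) → C_c(T_L, R_z)` of the twisted cellular
chain complex of the toric complex `T_L`:  on a basis element `c_σ`,
`σ = {v_1 < ⋯ < v_{c+1}}`, it is `∂^z c_σ = ∑ (-1)^{r-1} z_{v_r} c_{σ ∖ {v_r}}`. -/
noncomputable def tB (R : Type) [CommRing R] (L : Finset (Finset V)) (z : V → R) (c : ℕ) :
    (Face L (c+1) → R) →ₗ[R] (Face L c → R) :=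
  Matrix.mulVecLin (fun (τ : Face L c) (σ : Face L (c+1)) => coeffD z τ.1 σ.1)

/-- The Aomoto differential on the exterior Stanley--Reisner ring `k⟨L⟩`:  the degree-`c`
piece of `k⟨L⟩` has basis the faces of cardinality `c`, and right multiplication by
`z = ∑ z_v v*` sends the monomial `e_τ` to `∑_{v : τ ∪ {v} ∈ L} ± z_v e_{τ ∪ {v}}`. -/
noncomputable def aD (k : Type) [Field k] (L : Finset (Finset V)) (z : V → k) (c : ℕ) :
    (Face L c → k) →ₗ[k] (Face L (c+1) → k) :=
  Matrix.mulVecLin (fun (σ : Face L (c+1)) (τ : Face L c) => coeffD z τ.1 σ.1)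

/-- The Aomoto--Betti number `β_i(k⟨L⟩, z)`, the dimension of the `i`-th cohomology
of the Aomoto complex `(k⟨L⟩, ·z)`. -/
noncomputable def aomotoBetti (k : Type) [Field k] (L : Finset (Finset V)) (z : V → k)
    (i : ℕ) : ℕ :=
  Module.finrank k (LinearMap.ker (aD k L z i)) -
    (match i with
     | 0 => 0
     | j+1 => Module.finrank k (LinearMap.range (aD k L z j)))

/-- The canonical degree-one element `z_W = ∑_{v ∈ W} v*` of `k⟨L⟩`, as a weight vector. -/
def zW (k : Type) [Field k] (W : Finset V) : V → k := fun v => if v ∈ W then 1 else 0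

/-- The Aomoto--Betti number `β_i(k⟨L⟩, W) = β_i(k⟨L⟩, z_W)`. -/
noncomputable def aomotoBettiW (k : Type) [Field k] (L : Finset (Finset V)) (W : Finset V)
    (i : ℕ) : ℕ :=
  aomotoBetti k L (zW k W) i

/-- The cycles in cardinality-degree `n` of the twisted chain complex `C_•(T_L, R_z)`
(in degree `0` every chain is a cycle). -/
noncomputable def cyc (R : Type) [CommRing R] (L : Finset (Finset V)) (z : V → R) :
    (n : ℕ) → Submodule R (Face L n → R)
  | 0 => ⊤
  | (m+1) => LinearMap.ker (tB R L z m)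

/-- `dim_k H_n(C_•(T_L, k_z))`, the dimension of the `n`-th twisted homology of the
toric complex `T_L` with coefficients in the rank-one system determined by `z`. -/
noncomputable def twHomDim (k : Type) [Field k] (L : Finset (Finset V)) (z : V → k)
    (n : ℕ) : ℕ :=
  Module.finrank k ↥(cyc k L z n) - Module.finrank k ↥(LinearMap.range (tB k L z n))

/-- `dim_k H̃_j(K; k)`, the `j`-th reduced simplicial homology of the complex `K`
(the chain complex of `K` including the empty face is exactly the twisted complex
with all weights equal to `1`; the degree-`j` reduced homology sits in
cardinality-degree `j+1`). -/
noncomputable def reducedBetti (k : Type) [Field k] (K : Finset (Finset V)) (j : ℤ) : ℕ :=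
  if j < -1 then 0 else twHomDim k K (fun _ => (1 : k)) (j+1).toNat

/-- The link `lk_{L_W}(σ) = {τ ∈ L_W ∣ τ ∪ σ ∈ L}` of a face `σ` in the induced
subcomplex `L_W`. -/
def linkIn (L : Finset (Finset V)) (W σ : Finset V) : Finset (Finset V) :=
  L.filter (fun τ => τ ⊆ W ∧ τ ∪ σ ∈ L)

/-- The `n`-th homology of the twisted chain complex `C_•(T_L, R_z)`, as an `R`-module. -/
noncomputable def twHomology (R : Type) [CommRing R] (L : Finset (Finset V)) (z : V → R)
    (n : ℕ) :=
  ↥(cyc R L z n) ⧸ (LinearMap.range (tB R L z n)).comap (cyc R L z n).subtype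

/-- Rescaling the weights by `u` conjugates the incidence coefficients by the
face weights `∏ v ∈ σ, u v`. -/
theorem coeffD_smul_mul_prod {V : Type} [Fintype V] [LinearOrder V] {R : Type} [CommRing R]
    (u z : V → R) {τ σ : Finset V} (hc : σ.card = τ.card + 1) :
    coeffD (fun v => u v * z v) τ σ * ∏ v ∈ τ, u v = (∏ v ∈ σ, u v) * coeffD z τ σ := by
  unfold coeffD
  split_ifs with h
  · have h1 : (σ \ τ).card = 1 := by rw [card_sdiff_of_subset h]; omega
    obtain ⟨v, hv⟩ := card_eq_one.mp h1
    rw [← prod_sdiff h, hv]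
    simp only [sum_singleton, prod_singleton]
    ring
  · simp

/-- The diagonal rescaling of the degree-`c` piece of `k⟨L⟩` by the face weights
`∏ v ∈ σ, u v`. -/
noncomputable def faceScale {V : Type} {k : Type} [Field k] (L : Finset (Finset V))
    (u : V → k) (hu : ∀ v, u v ≠ 0) (c : ℕ) : (Face L c → k) ≃ₗ[k] (Face L c → k) :=
  LinearEquiv.piCongrRight fun σ =>
    LinearEquiv.smulOfUnit (Units.mk0 (∏ v ∈ σ.1, u v) (prod_ne_zero_iff.mpr fun v _ => hu v))

theorem aD_comp_faceScale {V : Type} [Fintype V] [LinearOrder V] {k : Type} [Field k]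
    (L : Finset (Finset V)) (z u : V → k) (hu : ∀ v, u v ≠ 0) (c : ℕ) :
    aD k L (fun v => u v * z v) c ∘ₗ (faceScale L u hu c).toLinearMap =
      (faceScale L u hu (c + 1)).toLinearMap ∘ₗ aD k L z c := by
  refine LinearMap.ext fun f => funext fun σ => ?_
  change ∑ τ : Face L c, coeffD (fun v => u v * z v) τ.1 σ.1 * ((∏ v ∈ τ.1, u v) * f τ) =
    (∏ v ∈ σ.1, u v) * ∑ τ : Face L c, coeffD z τ.1 σ.1 * f τ
  rw [mul_sum]
  refine sum_congr rfl fun τ _ => ?_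
  rw [← mul_assoc, coeffD_smul_mul_prod u z (by rw [σ.2.2, τ.2.2]), mul_assoc]

theorem finrank_range_aD_smul {V : Type} [Fintype V] [LinearOrder V] {k : Type} [Field k]
    (L : Finset (Finset V)) (z u : V → k) (hu : ∀ v, u v ≠ 0) (c : ℕ) :
    Module.finrank k (LinearMap.range (aD k L (fun v => u v * z v) c)) =
      Module.finrank k (LinearMap.range (aD k L z c)) := by
  rw [← LinearMap.range_comp_of_range_eq_top _ (faceScale L u hu c).range,
    aD_comp_faceScale, LinearMap.range_comp]
  exact LinearEquiv.finrank_map_eq _ _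

theorem finrank_ker_aD_smul {V : Type} [Fintype V] [LinearOrder V] {k : Type} [Field k]
    (L : Finset (Finset V)) (z u : V → k) (hu : ∀ v, u v ≠ 0) (c : ℕ) :
    Module.finrank k (LinearMap.ker (aD k L (fun v => u v * z v) c)) =
      Module.finrank k (LinearMap.ker (aD k L z c)) := by
  have h := LinearMap.finrank_range_add_finrank_ker (aD k L z c)
  have h' := LinearMap.finrank_range_add_finrank_ker (aD k L (fun v => u v * z v) c)
  rw [finrank_range_aD_smul L z u hu] at h'
  omega

theorem aomotoBetti_smul {V : Type} [Fintype V] [LinearOrder V] {k : Type} [Field k]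
    (L : Finset (Finset V)) (z u : V → k) (hu : ∀ v, u v ≠ 0) (i : ℕ) :
    aomotoBetti k L (fun v => u v * z v) i = aomotoBetti k L z i := by
  unfold aomotoBetti
  rw [finrank_ker_aD_smul L z u hu]
  cases i with
  | zero => rfl
  | succ j => simp only [finrank_range_aD_smul L z u hu]

/-- Lemma of Aramova--Avramov--Herzog.  If two degree-one elements
`z, z'` of the exterior Stanley--Reisner ring `k⟨L⟩` have the same support, then the
Aomoto--Betti numbers `β_i(k⟨L⟩, z)` and `β_i(k⟨L⟩, z')` agree for all `i ≥ 1`. -/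
theorem statement0 {V : Type} [Fintype V] [LinearOrder V] (k : Type) [Field k]
    (L : Finset (Finset V)) (hL : IsCx L) (hV : ∀ v : V, {v} ∈ L)
    (z z' : V → k) (hsupp : {v : V | z v ≠ 0} = {v : V | z' v ≠ 0}) :
    ∀ i : ℕ, 1 ≤ i → aomotoBetti k L z i = aomotoBetti k L z' i := by
  classical
  intro i _
  have hs (v : V) : z v ≠ 0 ↔ z' v ≠ 0 := Set.ext_iff.mp hsupp v
  have hz' : z' = fun v => (if z v = 0 then 1 else z' v / z v) * z v := by
    funext v
    by_cases h : z v = 0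
    · simpa [h] using hs v
    · simp [h]
  rw [hz', aomotoBetti_smul]
  intro v
  split_ifs with h
  · exact one_ne_zero
  · exact div_ne_zero ((hs v).mp h) h
end

section
/- Let k be a field, L a finite simplicial complex on vertex set V, and W' ⊆ W ⊆ V. Then β_i(k⟨L⟩, W') ≥ β_i(k⟨L⟩, W) for all i ≥ 1. -/
open Finset

variable {V : Type} [Fintype V] [LinearOrder V]

/-- If the rows and columns of `A` and `B` are graded so that `B` never lowers the degree and `A` is
the degree-preserving part of `B`, then `A.rank ≤ B.rank`. -/
theorem rank_le_rank_of_graded {m n k : Type*} [Fintype m] [Fintype n] [Field k]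
    (A B : Matrix m n k) (a : m → ℕ) (b : n → ℕ)
    (h_eq : ∀ i j, a i = b j → A i j = B i j) (h_ne : ∀ i j, a i ≠ b j → A i j = 0)
    (h_lt : ∀ i j, a i < b j → B i j = 0) : A.rank ≤ B.rank := by
  obtain ⟨κ, f, hf, hspan, hli⟩ := exists_linearIndependent' k A.col
  have : Finite κ := Finite.of_injective f hf
  have := Fintype.ofFinite κ
  have hB : LinearIndependent k (B.col ∘ f) := by
    rw [Fintype.linearIndependent_iff] at hli ⊢
    intro c hc
    -- induct on the degree: lower-degree coefficients vanish, so `A` sees the next ones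
    have key : ∀ N x, b (f x) = N → c x = 0 := by
      intro N
      induction N using Nat.strong_induction_on with
      | _ N ih =>
        intro x hx
        have h := hli (fun y => if b (f y) = N then c y else 0) ?_ x
        · simpa [hx] using h
        ext i
        simp only [Finset.sum_apply, Pi.smul_apply, Function.comp_apply, Matrix.col_apply,
          smul_eq_mul, Pi.zero_apply]
        by_cases hi : a i = N
        · have hci := congrFun hc i
          simp only [Finset.sum_apply, Pi.smul_apply, Function.comp_apply, Matrix.col_apply,
            smul_eq_mul, Pi.zero_apply] at hci
          refine (Finset.sum_congr rfl fun y _ => ?_).trans hci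
          rcases lt_trichotomy (b (f y)) N with hy | hy | hy
          · simp [ih _ hy y rfl]
          · simp [hy, h_eq i (f y) (hi.trans hy.symm)]
          · simp [hy.ne', h_lt i (f y) (hi ▸ hy)]
        · refine Finset.sum_eq_zero fun y _ => ?_
          split_ifs with hy
          · rw [h_ne i (f y) (fun h => hi (h.trans hy)), mul_zero]
          · exact zero_mul _
    exact fun x => key _ x rfl
  rw [Matrix.rank_eq_finrank_span_cols, Matrix.rank_eq_finrank_span_cols, ← hspan,
    finrank_span_eq_card hli, ← finrank_span_eq_card hB]
  exact Submodule.finrank_mono (Submodule.span_mono (Set.range_comp_subset_range f B.col))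

theorem coeffD_of_not_subset {V R : Type} [LinearOrder V] [CommRing R] (z : V → R)
    {τ σ : Finset V} (h : ¬ τ ⊆ σ) : coeffD z τ σ = 0 :=
  if_neg h

theorem coeffD_insert {V R : Type} [LinearOrder V] [CommRing R] (z : V → R)
    {τ : Finset V} {v : V} (hv : v ∉ τ) :
    coeffD z τ (insert v τ) = (-1) ^ (τ.filter (fun w => w < v)).card * z v := by
  simp [coeffD, Finset.insert_sdiff_cancel hv]

theorem finrank_range_aD_mono {V : Type} [Fintype V] [LinearOrder V] (k : Type) [Field k]
    (L : Finset (Finset V)) {W' W : Finset V} (hWW : W' ⊆ W) (c : ℕ) :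
    Module.finrank k (LinearMap.range (aD k L (zW k W') c)) ≤
      Module.finrank k (LinearMap.range (aD k L (zW k W) c)) := by
  have cover (σ : Face L (c + 1)) (τ : Face L c) (h : τ.1 ⊆ σ.1) :
      ∃ v, v ∉ τ.1 ∧ insert v τ.1 = σ.1 :=
    Finset.exists_eq_insert_iff.2 ⟨h, by rw [τ.2.2, σ.2.2]⟩
  refine rank_le_rank_of_graded _ _ (fun σ : Face L (c + 1) => (σ.1 ∩ (W \ W')).card)
    (fun τ : Face L c => (τ.1 ∩ (W \ W')).card) ?_ ?_ ?_
  all_goals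
    intro σ τ h
    beta_reduce at h ⊢
    by_cases hs : τ.1 ⊆ σ.1
    swap
    · simp [coeffD_of_not_subset _ hs]
  · obtain ⟨v, hv, hσ⟩ := cover σ τ hs
    rw [← hσ] at h ⊢
    have hvW : v ∉ W \ W' := fun hm => by
      simp [Finset.insert_inter_of_mem hm, hv] at h
    have : v ∈ W' ↔ v ∈ W :=
      ⟨fun hm => hWW hm, fun hm => by_contra fun hn => hvW (Finset.mem_sdiff.2 ⟨hm, hn⟩)⟩
    simp [coeffD_insert _ hv, zW, this]
  · obtain ⟨v, hv, hσ⟩ := cover σ τ hs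
    rw [← hσ] at h ⊢
    have hvW : v ∈ W \ W' := by_contra fun hm => h (by rw [Finset.insert_inter_of_notMem hm])
    simp [coeffD_insert _ hv, zW, (Finset.mem_sdiff.1 hvW).2]
  · exact absurd h (Finset.card_le_card (Finset.inter_subset_inter_right hs)).not_gt

/-- If `W' ⊆ W ⊆ V`, then `β_i(k⟨L⟩, W') ≥ β_i(k⟨L⟩, W)`
for all `i ≥ 1`. -/
theorem statement1 {V : Type} [Fintype V] [LinearOrder V] (k : Type) [Field k]
    (L : Finset (Finset V)) (hL : IsCx L) (hV : ∀ v : V, {v} ∈ L)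
    (W' W : Finset V) (hWW : W' ⊆ W) :
    ∀ i : ℕ, 1 ≤ i → aomotoBettiW k L W i ≤ aomotoBettiW k L W' i := by
  intro i hi
  obtain ⟨j, rfl⟩ := Nat.exists_eq_add_of_le' hi
  have h₀ := finrank_range_aD_mono k L hWW j
  have h₁ := finrank_range_aD_mono k L hWW (j + 1)
  have hW := LinearMap.finrank_range_add_finrank_ker (aD k L (zW k W) (j + 1))
  have hW' := LinearMap.finrank_range_add_finrank_ker (aD k L (zW k W') (j + 1))
  simp only [aomotoBettiW, aomotoBetti]
  omega
end

section
/- Let L be a finite simplicial complex on vertex set V and k a field. For all i ≥ 1 and d ≥ 1, the resonance variety R^i_d(k⟨L⟩) = {z ∈ k⟨L⟩¹ : β_i(k⟨L⟩, z) ≥ d} equals the union of the coordinate subspaces k^W = {z ∈ k⟨L⟩¹ : supp(z) ⊆ W}, taken over all subsets W ⊆ V with β_i(k⟨L⟩, W) ≥ d. -/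
open Finset

variable {V : Type} [Fintype V] [LinearOrder V]

/-- Passing from a block triangular matrix to its block diagonal part cannot decrease the
dimension of the kernel. -/
theorem finrank_ker_mulVecLin_le_of_blockDiagonal {k α β : Type} [Field k] [Fintype α]
    (M M' : Matrix β α k) (p : α → Prop) (q : β → Prop)
    (htri : ∀ σ τ, p τ → ¬ q σ → M σ τ = 0)
    (hdiag : ∀ σ τ, (p τ ↔ q σ) → M' σ τ = M σ τ)
    (hoff : ∀ σ τ, ¬ (p τ ↔ q σ) → M' σ τ = 0) :
    Module.finrank k (LinearMap.ker M.mulVecLin) ≤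
      Module.finrank k (LinearMap.ker M'.mulVecLin) := by
  classical
  let P : (α → k) →ₗ[k] (α → k) :=
    { toFun := fun x τ => if p τ then 0 else x τ
      map_add' := fun x y => by ext τ; by_cases h : p τ <;> simp [h]
      map_smul' := fun c x => by ext τ; by_cases h : p τ <;> simp [h] }
  have hP : ∀ x τ, P x τ = if p τ then 0 else x τ := fun _ _ => rfl
  set K := LinearMap.ker M.mulVecLin with hK
  have hmem : ∀ x, x ∈ K → ∀ σ, ∑ τ, M σ τ * x τ = 0 := fun x hx σ => congrFun hx σ
  have hmem' : ∀ x, (∀ σ, ∑ τ, M' σ τ * x τ = 0) → x ∈ LinearMap.ker M'.mulVecLin :=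
    fun x hx => funext hx
  have h1 : K ⊓ LinearMap.ker P ≤ LinearMap.ker M'.mulVecLin := by
    rintro x ⟨hxK, hxP⟩
    have hx0 : ∀ τ, ¬ p τ → x τ = 0 := fun τ hτ => by
      have := congrFun (LinearMap.mem_ker.1 hxP) τ
      simpa [hP, hτ] using this
    refine hmem' x fun σ => ?_
    by_cases hq : q σ
    · rw [← hmem x hxK σ]
      refine Finset.sum_congr rfl fun τ _ => ?_
      by_cases hp : p τ
      · rw [hdiag σ τ (by simp [hp, hq])]
      · simp [hx0 τ hp]
    · refine Finset.sum_eq_zero fun τ _ => ?_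
      by_cases hp : p τ
      · rw [hoff σ τ (by simp [hp, hq]), zero_mul]
      · simp [hx0 τ hp]
  have h2 : K.map P ≤ LinearMap.ker M'.mulVecLin := by
    rintro _ ⟨x, hxK, rfl⟩
    refine hmem' _ fun σ => ?_
    by_cases hq : q σ
    · refine Finset.sum_eq_zero fun τ _ => ?_
      by_cases hp : p τ
      · simp [hP, hp]
      · rw [hoff σ τ (by simp [hp, hq]), zero_mul]
    · rw [← hmem x hxK σ]
      refine Finset.sum_congr rfl fun τ _ => ?_
      by_cases hp : p τ
      · simp [hP, hp, htri σ τ hp hq]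
      · rw [hdiag σ τ (by simp [hp, hq])]
        simp [hP, hp]
  have hinf : (K ⊓ LinearMap.ker P) ⊓ K.map P = ⊥ := by
    rw [eq_bot_iff]
    rintro _ ⟨⟨_, hx⟩, y, _, rfl⟩
    have hPP : P (P y) = P y := by
      ext τ
      by_cases h : p τ <;> simp [hP, h]
    simpa [hPP] using hx
  have hrn := LinearMap.finrank_range_add_finrank_ker (P.domRestrict K)
  rw [LinearMap.range_domRestrict] at hrn
  have hker : Module.finrank k (LinearMap.ker (P.domRestrict K)) =
      Module.finrank k (K ⊓ LinearMap.ker P : Submodule k (α → k)) := by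
    rw [← Submodule.map_comap_subtype, Submodule.finrank_map_subtype_eq]
    rfl
  have hsum := Submodule.finrank_sup_add_finrank_inf_eq (K ⊓ LinearMap.ker P) (K.map P)
  rw [hinf, finrank_bot, add_zero] at hsum
  have := Submodule.finrank_mono (sup_le h1 h2)
  omega

/-- Zeroing one weight cannot decrease the dimension of the kernel of the Aomoto
differential. -/
theorem finrank_ker_aD_le_update {V : Type} [Fintype V] [LinearOrder V] (k : Type) [Field k]
    (L : Finset (Finset V)) (z : V → k) (v : V) (c : ℕ) :
    Module.finrank k (LinearMap.ker (aD k L z c)) ≤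
      Module.finrank k (LinearMap.ker (aD k L (Function.update z v 0) c)) := by
  refine finrank_ker_mulVecLin_le_of_blockDiagonal _ _ (fun τ => v ∈ τ.1) (fun σ => v ∈ σ.1)
    ?_ ?_ ?_
  · intro σ τ hτ hσ
    exact if_neg fun h => hσ (h hτ)
  · intro σ τ h
    unfold coeffD
    split_ifs with hsub
    · refine Finset.sum_congr rfl fun w hw => ?_
      have hwv : w ≠ v := by
        rintro rfl
        rw [Finset.mem_sdiff] at hw
        exact hw.2 (h.2 hw.1)
      rw [Function.update_of_ne hwv]
    · rfl
  · intro σ τ h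
    unfold coeffD
    split_ifs with hsub
    · have hcard : (σ.1 \ τ.1).card = 1 := by
        rw [Finset.card_sdiff_of_subset hsub, σ.2.2, τ.2.2]
        omega
      obtain ⟨w, hw⟩ := Finset.card_eq_one.1 hcard
      have hv : v ∈ σ.1 \ τ.1 := by
        have := @hsub v
        rw [Finset.mem_sdiff]
        tauto
      rw [hw, Finset.mem_singleton] at hv
      rw [hw, Finset.sum_singleton, ← hv, Function.update_self, mul_zero]
    · rfl

/-- Rescaling the weights by `u` conjugates the incidence coefficients by the monomials
in `u`. -/
theorem coeffD_mul {V R : Type} [Fintype V] [LinearOrder V] [CommRing R] (a u : V → R)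
    {τ σ : Finset V} (h : σ.card = τ.card + 1) :
    coeffD (a * u) τ σ * ∏ v ∈ τ, u v = (∏ v ∈ σ, u v) * coeffD a τ σ := by
  unfold coeffD
  split_ifs with hsub
  · have hcard : (σ \ τ).card = 1 := by
      rw [Finset.card_sdiff_of_subset hsub, h]
      omega
    obtain ⟨w, hw⟩ := Finset.card_eq_one.1 hcard
    rw [← Finset.prod_sdiff hsub, hw, Finset.sum_singleton, Finset.sum_singleton,
      Finset.prod_singleton, Pi.mul_apply]
    ring
  · simp

theorem finrank_ker_aD_le_mul {V : Type} [Fintype V] [LinearOrder V] (k : Type) [Field k]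
    (L : Finset (Finset V)) (a u : V → k) (hu : ∀ v, u v ≠ 0) (c : ℕ) :
    Module.finrank k (LinearMap.ker (aD k L a c)) ≤
      Module.finrank k (LinearMap.ker (aD k L (a * u) c)) := by
  let Φ : (Face L c → k) →ₗ[k] (Face L c → k) :=
    { toFun := fun x τ => (∏ v ∈ τ.1, u v) * x τ
      map_add' := fun x y => by ext τ; simp [mul_add]
      map_smul' := fun c x => by ext τ; simp [mul_left_comm] }
  have hΦ : Function.Injective Φ := fun x y hxy => by
    ext τ
    exact mul_left_cancel₀ (Finset.prod_ne_zero_iff.2 fun v _ => hu v) (congrFun hxy τ)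
  rw [(Submodule.equivMapOfInjective Φ hΦ (LinearMap.ker (aD k L a c))).finrank_eq]
  refine Submodule.finrank_mono ?_
  rintro _ ⟨x, hx, rfl⟩
  have hx' : ∀ σ : Face L (c + 1), ∑ τ : Face L c, coeffD a τ.1 σ.1 * x τ = 0 :=
    fun σ => congrFun hx σ
  refine LinearMap.mem_ker.2 (funext fun σ => ?_)
  change ∑ τ : Face L c, coeffD (a * u) τ.1 σ.1 * ((∏ v ∈ τ.1, u v) * x τ) = 0
  rw [← mul_zero (∏ v ∈ σ.1, u v), ← hx' σ, Finset.mul_sum]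
  refine Finset.sum_congr rfl fun τ _ => ?_
  rw [← mul_assoc, coeffD_mul a u (by rw [σ.2.2, τ.2.2]), mul_assoc]

/-- The dimension of the kernel of the Aomoto differential is antitone in the support of
the weights. -/
theorem finrank_ker_aD_anti {V : Type} [Fintype V] [LinearOrder V] (k : Type) [Field k]
    (L : Finset (Finset V)) {z z' : V → k} (h : ∀ v, z v ≠ 0 → z' v ≠ 0) (c : ℕ) :
    Module.finrank k (LinearMap.ker (aD k L z' c)) ≤
      Module.finrank k (LinearMap.ker (aD k L z c)) := by
  classical
  have hzero : ∀ S : Finset V, Module.finrank k (LinearMap.ker (aD k L z' c)) ≤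
      Module.finrank k (LinearMap.ker (aD k L (fun v => if v ∈ S then 0 else z' v) c)) := by
    intro S
    induction S using Finset.induction_on with
    | empty =>
      simp
      exact le_rfl
    | insert v S _ ih =>
      have heq : (fun w => if w ∈ insert v S then 0 else z' w) =
          Function.update (fun w => if w ∈ S then 0 else z' w) v 0 := by
        ext w
        by_cases hw : w = v
        · subst hw
          simp
        · simp [hw]
      rw [heq]
      exact ih.trans (finrank_ker_aD_le_update k L _ v c)
  have hu : ∀ v, (if z v = 0 then 1 else z v / z' v) ≠ 0 := fun v => by
    split_ifs with hv
    · exact one_ne_zero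
    · exact div_ne_zero hv (h v hv)
  have heq : z = (fun v => if v ∈ univ.filter (fun w => z w = 0) then 0 else z' v) *
      fun v => if z v = 0 then 1 else z v / z' v := by
    ext v
    by_cases hv : z v = 0
    · simp [hv]
    · simp [hv, mul_div_cancel₀ _ (h v hv)]
  refine (hzero (univ.filter fun v => z v = 0)).trans ?_
  conv_rhs => rw [heq]
  exact finrank_ker_aD_le_mul k L _ _ hu c

theorem aomotoBetti_anti {V : Type} [Fintype V] [LinearOrder V] (k : Type) [Field k]
    (L : Finset (Finset V)) {z z' : V → k} (h : ∀ v, z v ≠ 0 → z' v ≠ 0) (i : ℕ) :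
    aomotoBetti k L z' i ≤ aomotoBetti k L z i := by
  have hi := finrank_ker_aD_anti k L h i
  cases i with
  | zero => simpa [aomotoBetti] using hi
  | succ j =>
    have hj := finrank_ker_aD_anti k L h j
    have hr := LinearMap.finrank_range_add_finrank_ker (aD k L z j)
    have hr' := LinearMap.finrank_range_add_finrank_ker (aD k L z' j)
    simp only [aomotoBetti]
    omega


/-- The resonance variety `R^i_d(k⟨L⟩) = {z ∈ k⟨L⟩¹ : β_i(k⟨L⟩,z) ≥ d}`
is the union of the coordinate subspaces `k^W = {z : supp z ⊆ W}` over all subsets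
`W ⊆ V` with `β_i(k⟨L⟩, W) ≥ d`. -/
theorem statement4 {V : Type} [Fintype V] [LinearOrder V] (k : Type) [Field k]
    (L : Finset (Finset V)) (hL : IsCx L) (hV : ∀ v : V, {v} ∈ L)
    (i d : ℕ) (hi : 1 ≤ i) (hd : 1 ≤ d) :
    ∀ z : V → k,
      d ≤ aomotoBetti k L z i ↔
        ∃ W : Finset V, d ≤ aomotoBettiW k L W i ∧ ∀ v : V, z v ≠ 0 → v ∈ W := by
  classical
  intro z
  constructor
  · intro h
    refine ⟨univ.filter fun v => z v ≠ 0, h.trans (aomotoBetti_anti k L (fun v hv => ?_) i),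
      fun v hv => by simpa using hv⟩
    simpa [zW] using hv
  · rintro ⟨W, hW, hz⟩
    exact hW.trans (aomotoBetti_anti k L (fun v hv => by simp [zW, hz v hv]) i)
end

section
/- Let Γ = (V, E) be a finite simple graph, Δ_Γ its flag complex, and k a field. Then the first resonance variety R¹₁(k⟨Δ_Γ⟩) = {z ∈ k⟨Δ_Γ⟩¹ : β_1(k⟨Δ_Γ⟩, z) ≥ 1} equals the union of the coordinate subspaces k^W = {z : supp(z) ⊆ W}, taken over all subsets W ⊆ V such that the induced subgraph Γ_W is disconnected. -/
open Finset

variable {V : Type} [Fintype V] [LinearOrder V]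

/-- The flag complex `Δ_Γ` of a finite simple graph `Γ`: its faces are the cliques
of `Γ` (including the empty clique and the vertices). -/
def flagCx {V : Type} [Fintype V] [LinearOrder V] (Γ : SimpleGraph V) [DecidableRel Γ.Adj] :
    Finset (Finset V) :=
  Finset.univ.filter (fun σ => ∀ u ∈ σ, ∀ v ∈ σ, u ≠ v → Γ.Adj u v)

section Resonance

variable {k : Type} [Field k] (Γ : SimpleGraph V) [DecidableRel Γ.Adj]

/-- The vertices of `Γ` are the faces of cardinality one of its flag complex. -/
noncomputable def vertexFace : V ≃ Face (flagCx Γ) 1 :=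
  Equiv.ofBijective (fun v => ⟨{v}, by simp [flagCx]⟩) <| by
    constructor
    · intro u v h
      simpa using h
    · rintro ⟨σ, hσ, hc⟩
      obtain ⟨v, rfl⟩ := Finset.card_eq_one.mp hc
      exact ⟨v, rfl⟩

lemma vertexFace_val (v : V) : (vertexFace Γ v).1 = {v} := rfl

omit [Fintype V] in
lemma coeffD_empty_singleton (z : V → k) (v : V) : coeffD z ∅ {v} = z v := by
  simp [coeffD]

omit [Fintype V] in
lemma coeffD_left_of_lt (z : V → k) {u v : V} (h : u < v) : coeffD z {u} {u, v} = -z v := by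
  have : ({u, v} : Finset V) \ {u} = {v} := by
    ext w; simp; grind
  simp [coeffD, this, Finset.filter_singleton, h]

omit [Fintype V] in
lemma coeffD_right_of_lt (z : V → k) {u v : V} (h : u < v) : coeffD z {v} {u, v} = z u := by
  have : ({u, v} : Finset V) \ {v} = {u} := by
    ext w; simp; grind
  simp [coeffD, this, Finset.filter_singleton, h.not_gt]

omit [Fintype V] in
lemma coeffD_singleton_eq_zero (z : V → k) {w : V} {σ : Finset V} (h : w ∉ σ) :
    coeffD z {w} σ = 0 := by
  simp [coeffD, h]

lemma aD_one_apply (z : V → k) (x : Face (flagCx Γ) 1 → k) {u v : V} (h : u < v)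
    (σ : Face (flagCx Γ) 2) (hσ : σ.1 = {u, v}) :
    aD k (flagCx Γ) z 1 x σ = z u * x (vertexFace Γ v) - z v * x (vertexFace Γ u) := by
  change ∑ τ, coeffD z τ.1 σ.1 * x τ = _
  rw [← (vertexFace Γ).sum_comp, ← Finset.sum_subset (Finset.subset_univ {u, v}),
    Finset.sum_pair h.ne]
  · simp only [vertexFace_val, hσ, coeffD_left_of_lt z h, coeffD_right_of_lt z h]
    ring
  · intro w _ hw
    rw [vertexFace_val, hσ, coeffD_singleton_eq_zero z hw, zero_mul]

lemma mem_ker_aD_one (z : V → k) (x : Face (flagCx Γ) 1 → k) :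
    x ∈ LinearMap.ker (aD k (flagCx Γ) z 1) ↔
      ∀ u v, Γ.Adj u v → x (vertexFace Γ u) * z v = x (vertexFace Γ v) * z u := by
  rw [LinearMap.mem_ker]
  constructor
  · intro hx
    have key : ∀ u v, u < v → Γ.Adj u v →
        x (vertexFace Γ u) * z v = x (vertexFace Γ v) * z u := by
      intro u v huv hadj
      have hmem : ({u, v} : Finset V) ∈ flagCx Γ := by
        simp [flagCx, hadj, hadj.symm]
      have h := aD_one_apply Γ z x huv ⟨{u, v}, hmem, Finset.card_pair huv.ne⟩ rfl
      rw [hx, Pi.zero_apply] at h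
      linear_combination h
    intro u v hadj
    rcases lt_or_gt_of_ne hadj.ne with h | h
    · exact key u v h hadj
    · exact (key v u h hadj.symm).symm
  · intro hx
    ext ⟨σ, hσ, hc⟩
    obtain ⟨u, v, huv, rfl⟩ := Finset.card_eq_two.mp hc
    have hadj : Γ.Adj u v := by
      simp only [flagCx, Finset.mem_filter] at hσ
      exact hσ.2 u (by simp) v (by simp) huv
    have hcomm := hx u v hadj
    rcases lt_or_gt_of_ne huv with h | h
    · rw [aD_one_apply Γ z x h _ rfl, Pi.zero_apply]
      linear_combination -hcomm
    · rw [aD_one_apply Γ z x h _ (Finset.pair_comm u v), Pi.zero_apply]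
      linear_combination hcomm

lemma aD_zero_apply (z : V → k) (x : Face (flagCx Γ) 0 → k) (v : V) :
    aD k (flagCx Γ) z 0 x (vertexFace Γ v) = x ⟨∅, by simp [flagCx]⟩ * z v := by
  change ∑ τ : Face (flagCx Γ) 0, coeffD z τ.1 {v} * x τ = _
  rw [Fintype.sum_eq_single ⟨∅, by simp [flagCx]⟩, coeffD_empty_singleton, mul_comm]
  rintro ⟨τ, hτ, hc⟩ hne
  exact absurd (Subtype.ext (Finset.card_eq_zero.mp hc)) hne

lemma mem_range_aD_zero (z : V → k) (x : Face (flagCx Γ) 1 → k) :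
    x ∈ LinearMap.range (aD k (flagCx Γ) z 0) ↔ ∃ c : k, ∀ v, x (vertexFace Γ v) = c * z v := by
  constructor
  · rintro ⟨y, rfl⟩
    exact ⟨_, aD_zero_apply Γ z y⟩
  · rintro ⟨c, hc⟩
    refine ⟨fun _ => c, funext fun σ => ?_⟩
    obtain ⟨v, rfl⟩ := (vertexFace Γ).surjective σ
    rw [aD_zero_apply, hc]

lemma one_le_aomotoBetti_one_iff (z : V → k) :
    1 ≤ aomotoBetti k (flagCx Γ) z 1 ↔
      ∃ y : V → k, (∀ u v, Γ.Adj u v → y u * z v = y v * z u) ∧ ¬ ∃ c : k, ∀ v, y v = c * z v := by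
  have hle : LinearMap.range (aD k (flagCx Γ) z 0) ≤ LinearMap.ker (aD k (flagCx Γ) z 1) := by
    intro x hx
    obtain ⟨c, hc⟩ := (mem_range_aD_zero Γ z x).mp hx
    rw [mem_ker_aD_one]
    intro u v _
    rw [hc, hc]
    ring
  have hlt : 1 ≤ aomotoBetti k (flagCx Γ) z 1 ↔
      ¬ LinearMap.ker (aD k (flagCx Γ) z 1) ≤ LinearMap.range (aD k (flagCx Γ) z 0) := by
    simp only [aomotoBetti, Nat.one_le_iff_ne_zero, ne_eq, Nat.sub_eq_zero_iff_le]
    refine not_congr ⟨fun h => (Submodule.eq_of_le_of_finrank_le hle h).ge, ?_⟩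
    exact Submodule.finrank_mono
  rw [hlt, SetLike.not_le_iff_exists]
  simp only [mem_ker_aD_one, mem_range_aD_zero]
  constructor
  · rintro ⟨x, hx⟩
    exact ⟨fun v => x (vertexFace Γ v), hx⟩
  · rintro ⟨y, hy⟩
    exact ⟨fun σ => y ((vertexFace Γ).symm σ), by simpa using hy⟩

omit [Fintype V] [DecidableRel Γ.Adj] in
lemma exists_nontrivial_of_isolated (z : V → k) (b : V) (hb : z b = 0)
    (hadj : ∀ v, Γ.Adj b v → z v = 0) :
    ∃ y : V → k, (∀ u v, Γ.Adj u v → y u * z v = y v * z u) ∧ ¬ ∃ c : k, ∀ v, y v = c * z v := by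
  refine ⟨Pi.single b 1, fun u v huv => ?_, ?_⟩
  · have key : ∀ u v, Γ.Adj u v → (Pi.single b 1 : V → k) u * z v = 0 := by
      intro u v huv
      rcases eq_or_ne u b with rfl | h
      · simp [hadj v huv]
      · simp [h]
    rw [key u v huv, key v u huv.symm]
  · rintro ⟨c, hc⟩
    simpa [hb] using hc b

lemma exists_nontrivial_of_not_connected [Nonempty V] (z : V → k) (W : Finset V)
    (hW : ¬ (Γ.induce (W : Set V)).Connected) (hz : ∀ v, z v ≠ 0 → v ∈ W) :
    ∃ y : V → k, (∀ u v, Γ.Adj u v → y u * z v = y v * z u) ∧ ¬ ∃ c : k, ∀ v, y v = c * z v := by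
  classical
  rcases W.eq_empty_or_nonempty with rfl | ⟨w, hw⟩
  · obtain ⟨b⟩ := ‹Nonempty V›
    have h0 : ∀ v, z v = 0 := fun v => by_contra fun h => absurd (hz v h) (Finset.notMem_empty v)
    exact exists_nontrivial_of_isolated Γ z b (h0 b) fun v _ => h0 v
  have hpre : ¬ (Γ.induce (W : Set V)).Preconnected := fun h =>
    hW ((SimpleGraph.connected_iff _).mpr ⟨h, ⟨⟨w, hw⟩⟩⟩)
  simp only [SimpleGraph.Preconnected, not_forall] at hpre
  obtain ⟨a, b, hab⟩ := hpre
  let p : V → Prop := fun v => ∃ h : v ∈ (W : Set V), (Γ.induce (W : Set V)).Reachable a ⟨v, h⟩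
  have hpa : p a := ⟨a.2, .refl _⟩
  have hpb : ¬ p b := fun ⟨_, h⟩ => hab h
  have step : ∀ u v, Γ.Adj u v → u ∈ W → v ∈ W → p u → p v := by
    rintro u v huv - hv ⟨hu, hr⟩
    have : (Γ.induce (W : Set V)).Adj ⟨u, hu⟩ ⟨v, hv⟩ := huv
    exact ⟨hv, hr.trans this.reachable⟩
  by_cases hA : ∀ v, p v → z v = 0
  · refine exists_nontrivial_of_isolated Γ z a (hA a hpa) fun v hv => by_contra fun h => ?_
    exact h (hA v (step a v hv a.2 (hz v h) hpa))
  by_cases hB : ∀ v, ¬ p v → z v = 0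
  · refine exists_nontrivial_of_isolated Γ z b (hB b hpb) fun v hv => by_contra fun h => ?_
    exact h (hB v fun hp => hpb (step v b hv.symm (hz v h) b.2 hp))
  push Not at hA hB
  obtain ⟨s, hs, hzs⟩ := hA
  obtain ⟨t, ht, hzt⟩ := hB
  refine ⟨fun v => if p v then z v else 0, fun u v huv => ?_, ?_⟩
  · by_cases hu : z u = 0
    · simp [hu]
    by_cases hv : z v = 0
    · simp [hv]
    have hp : p u ↔ p v :=
      ⟨step u v huv (hz u hu) (hz v hv), step v u huv.symm (hz v hv) (hz u hu)⟩
    simp only [hp]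
    split_ifs <;> ring
  · rintro ⟨c, hc⟩
    have h1 := hc s
    have h2 := hc t
    simp only [hs, ht, if_true, if_false] at h1 h2
    have hc0 : c = 0 := (mul_eq_zero.mp h2.symm).resolve_right hzt
    exact hzs (by simpa [hc0] using h1)

lemma exists_not_connected_of_nontrivial (z y : V → k)
    (hy : ∀ u v, Γ.Adj u v → y u * z v = y v * z u) (hyz : ¬ ∃ c : k, ∀ v, y v = c * z v) :
    ∃ W : Finset V, ¬ (Γ.induce (W : Set V)).Connected ∧ ∀ v : V, z v ≠ 0 → v ∈ W := by
  classical
  by_contra! hcon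
  have hconn : ∀ W : Finset V, (∀ v, z v ≠ 0 → v ∈ W) → (Γ.induce (W : Set V)).Connected := by
    intro W hW
    by_contra h
    obtain ⟨v, hv, hvW⟩ := hcon W h
    exact hvW (hW v hv)
  let S : Finset V := Finset.univ.filter fun v => z v ≠ 0
  have hmem : ∀ v, v ∈ S ↔ z v ≠ 0 := by simp [S]
  have hS := hconn S fun v => (hmem v).mpr
  obtain ⟨a⟩ := hS.nonempty
  have hza : z a ≠ 0 := (hmem a).mp a.2
  have hratio : ∀ s t : (S : Set V), (Γ.induce (S : Set V)).Reachable s t →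
      y s / z s = y t / z t := by
    rintro s t ⟨w⟩
    induction w with
    | nil => rfl
    | @cons u v _ h _ ih =>
      rw [← ih, div_eq_div_iff ((hmem u).mp u.2) ((hmem v).mp v.2)]
      exact hy u v h
  refine hyz ⟨y a / z a, fun b => ?_⟩
  by_cases hb : z b = 0
  · rw [hb, mul_zero]
    have hT := hconn (insert b S) fun v hv => Finset.mem_insert_of_mem ((hmem v).mpr hv)
    have hab : (a : V) ≠ b := fun h => hza (h ▸ hb)
    have : Nontrivial ((insert b S : Finset V) : Set V) :=
      ⟨⟨b, by simp⟩, ⟨a, by simp⟩, fun h => hab (congrArg Subtype.val h).symm⟩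
    obtain ⟨⟨v, hvT⟩, hv⟩ := hT.preconnected.exists_adj_of_nontrivial ⟨b, by simp⟩
    have hbv : Γ.Adj b v := hv
    have hzv : z v ≠ 0 := (hmem v).mp ((Finset.mem_insert.mp hvT).resolve_left hbv.ne')
    have h := hy b v hbv
    rw [hb, mul_zero] at h
    exact (mul_eq_zero.mp h).resolve_right hzv
  · rw [hratio a ⟨b, (hmem b).mpr hb⟩ (hS.preconnected _ _), div_mul_cancel₀ _ hb]

end Resonance

/-- first resonance variety of a right-angled Artin group.
`R¹₁(k⟨Δ_Γ⟩)` is the union of the coordinate subspaces `k^W` over all `W ⊆ V`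
whose induced subgraph `Γ_W` is disconnected. -/
theorem statement5 {V : Type} [Fintype V] [LinearOrder V] [Nonempty V] (k : Type) [Field k]
    (Γ : SimpleGraph V) [DecidableRel Γ.Adj] :
    ∀ z : V → k,
      1 ≤ aomotoBetti k (flagCx Γ) z 1 ↔
        ∃ W : Finset V, ¬ (Γ.induce (W : Set V)).Connected ∧ ∀ v : V, z v ≠ 0 → v ∈ W := by
  intro z
  rw [one_le_aomotoBetti_one_iff]
  constructor
  · rintro ⟨y, hy, hyz⟩
    exact exists_not_connected_of_nontrivial Γ z y hy hyz
  · rintro ⟨W, hW, hz⟩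
    exact exists_nontrivial_of_not_connected Γ z W hW hz
end

section
/- Let L be a finite simplicial complex on vertex set V and k a field. For ρ ∈ (k^×)^V let γ(ρ)_v = ρ_v − 1. Then for all i ≥ 1 and d ≥ 1, the set {ρ ∈ (k^×)^V : dim_k H_i(C_•(T_L, k_{γ(ρ)})) ≥ d} equals the union of the coordinate subtori (k^×)^W = {ρ ∈ (k^×)^V : ρ_v = 1 for all v ∉ W}, taken over all subsets W ⊆ V with β_i(k⟨L⟩, W) ≥ d. -/
open Finset

variable {V : Type} [Fintype V] [LinearOrder V]

namespace Matrix

/-- A matrix of rank `r` over a field has `r` linearly independent rows. -/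
theorem exists_linearIndependent_rows {K m n : Type*} [Field K] [Fintype m] [Fintype n]
    (A : Matrix m n K) {r : ℕ} (hr : A.rank = r) :
    ∃ f : Fin r → m, LinearIndependent K (A.submatrix f id).row := by
  subst hr
  rw [A.rank_eq_finrank_span_row]
  obtain ⟨g, hg, -, hli⟩ := Submodule.exists_fun_fin_finrank_span_eq K (Set.range A.row)
  choose f hf using hg
  refine ⟨f, ?_⟩
  rwa [show (A.submatrix f id).row = g from funext hf]

/-- A matrix of rank `r` over a field has a nonzero minor of size `r`. -/
theorem exists_minor_ne_zero {K m n : Type*} [Field K] [Fintype m] [Fintype n]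
    (A : Matrix m n K) :
    ∃ (f : Fin A.rank → m) (g : Fin A.rank → n), (A.submatrix f g).det ≠ 0 := by
  obtain ⟨f, hf⟩ := A.exists_linearIndependent_rows rfl
  have hrank : (A.submatrix f id)ᵀ.rank = A.rank := by
    rw [rank_transpose, hf.rank_matrix, Fintype.card_fin]
  obtain ⟨g, hg⟩ := (A.submatrix f id)ᵀ.exists_linearIndependent_rows hrank
  refine ⟨f, g, ?_⟩
  rw [linearIndependent_rows_iff_isUnit, isUnit_iff_isUnit_det] at hg
  rw [← det_transpose]
  exact hg.ne_zero

theorem le_rank_of_minor_ne_zero {K m n : Type*} [Field K] [Fintype m] [Fintype n] {r : ℕ}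
    (A : Matrix m n K) (f : Fin r → m) (g : Fin r → n) (h : (A.submatrix f g).det ≠ 0) :
    r ≤ A.rank := by
  simpa [rank_of_det_ne_zero h] using A.rank_submatrix_le f g

end Matrix

theorem coeffD_map {V : Type} [LinearOrder V] {R S : Type} [CommRing R] [CommRing S] (φ : R →+* S) (z : V → R)
    (τ σ : Finset V) : φ (coeffD z τ σ) = coeffD (fun v => φ (z v)) τ σ := by
  unfold coeffD
  split_ifs <;> simp

/-- Rescaling the weights by `u` conjugates the incidence coefficients by the products of `u`
over faces. -/
theorem prod_mul_coeffD {V : Type} [LinearOrder V] {R : Type} [CommRing R] (u z : V → R)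
    {τ σ : Finset V} (h : σ.card = τ.card + 1) :
    (∏ v ∈ τ, u v) * coeffD (fun v => u v * z v) τ σ = coeffD z τ σ * ∏ v ∈ σ, u v := by
  unfold coeffD
  split_ifs with hs
  · obtain ⟨v, hv⟩ := Finset.card_eq_one.1
      (show (σ \ τ).card = 1 by rw [Finset.card_sdiff_of_subset hs]; omega)
    rw [← Finset.prod_sdiff hs, hv]
    simp only [Finset.sum_singleton, Finset.prod_singleton]
    ring
  · simp

/-- The matrix of incidence coefficients of `L` between cardinalities `c` and `c + 1`. -/
def incidenceD {R : Type} [CommRing R] (L : Finset (Finset V)) (z : V → R) (c : ℕ) :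
    Matrix (Face L c) (Face L (c + 1)) R :=
  fun τ σ => coeffD z τ.1 σ.1

/-- The rank of the twisted boundary matrix is monotone in the support of the weights. -/
theorem rank_incidenceD_le {k : Type} [Field k] (L : Finset (Finset V)) (z w : V → k) (c : ℕ)
    (h : ∀ v, z v ≠ 0 → w v ≠ 0) :
    (incidenceD L z c).rank ≤ (incidenceD L w c).rank := by
  classical
  obtain ⟨f, g, hfg⟩ := (incidenceD L z c).exists_minor_ne_zero
  refine (incidenceD L w c).le_rank_of_minor_ne_zero f g fun h0 => hfg ?_
  let u : V → Polynomial k := fun v =>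
    if z v = 0 then Polynomial.X else Polynomial.C (z v / w v)
  have hu : ∀ v, u v ≠ 0 := by
    intro v
    simp only [u]
    split_ifs with hz
    · exact Polynomial.X_ne_zero
    · exact Polynomial.C_ne_zero.2 (div_ne_zero hz (h v hz))
  have hu0 : ∀ v, (u v).eval 0 * w v = z v := by
    intro v
    simp only [u]
    split_ifs with hz
    · simp [hz]
    · simp [div_mul_cancel₀ _ (h v hz)]
  let y : V → Polynomial k := fun v => u v * Polynomial.C (w v)
  have hscale : Matrix.diagonal (fun i => ∏ v ∈ (f i).1, u v) * (incidenceD L y c).submatrix f g =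
      ((incidenceD L w c).submatrix f g).map Polynomial.C *
        Matrix.diagonal (fun j => ∏ v ∈ (g j).1, u v) := by
    ext1 i j
    rw [Matrix.diagonal_mul, Matrix.mul_diagonal]
    simp only [Matrix.submatrix_apply, Matrix.map_apply, incidenceD, y]
    rw [coeffD_map]
    exact prod_mul_coeffD _ _ ((g j).2.2.trans (by rw [(f i).2.2]))
  have hy : ((incidenceD L y c).submatrix f g).det = 0 := by
    have hdet := congrArg Matrix.det hscale
    rw [Matrix.det_mul, Matrix.det_mul, Matrix.det_diagonal, ← RingHom.mapMatrix_apply,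
      ← RingHom.map_det, h0, map_zero, zero_mul] at hdet
    exact (mul_eq_zero.1 hdet).resolve_left
      (Finset.prod_ne_zero_iff.2 fun i _ => Finset.prod_ne_zero_iff.2 fun v _ => hu v)
  have heval : (incidenceD L z c).submatrix f g =
      (Polynomial.evalRingHom (0 : k)).mapMatrix ((incidenceD L y c).submatrix f g) := by
    ext1 i j
    simp only [RingHom.mapMatrix_apply, Matrix.map_apply, Matrix.submatrix_apply, incidenceD]
    rw [coeffD_map]
    congr 1
    funext v
    simp [y, hu0]
  rw [heval, ← RingHom.map_det, hy, map_zero]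

theorem twHomDim_succ {k : Type} [Field k] (L : Finset (Finset V)) (z : V → k) (j : ℕ) :
    twHomDim k L z (j + 1) = Fintype.card (Face L (j + 1)) - (incidenceD L z j).rank -
      (incidenceD L z (j + 1)).rank := by
  have h := (tB k L z j).finrank_range_add_finrank_ker
  rw [Module.finrank_fintype_fun_eq_card] at h
  have h1 : Module.finrank k (LinearMap.range (tB k L z j)) = (incidenceD L z j).rank := rfl
  have h2 : Module.finrank k (LinearMap.range (tB k L z (j + 1))) =
    (incidenceD L z (j + 1)).rank := rfl
  change Module.finrank k (LinearMap.ker (tB k L z j)) -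
    Module.finrank k (LinearMap.range (tB k L z (j + 1))) = _
  rw [h2, ← h, h1, Nat.add_sub_cancel_left]

theorem aomotoBetti_succ {k : Type} [Field k] (L : Finset (Finset V)) (z : V → k) (j : ℕ) :
    aomotoBetti k L z (j + 1) = Fintype.card (Face L (j + 1)) - (incidenceD L z j).rank -
      (incidenceD L z (j + 1)).rank := by
  have h := (aD k L z (j + 1)).finrank_range_add_finrank_ker
  rw [Module.finrank_pi] at h
  have h1 : Module.finrank k (LinearMap.range (aD k L z j)) = (incidenceD L z j).rank :=
    (incidenceD L z j).rank_transpose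
  have h2 : Module.finrank k (LinearMap.range (aD k L z (j + 1))) =
    (incidenceD L z (j + 1)).rank := (incidenceD L z (j + 1)).rank_transpose
  simp only [aomotoBetti]
  omega

/-- The Aomoto-Betti numbers `β_i`, `i ≥ 1`, are antitone in the support of the weights, and agree
with the twisted Betti numbers of the toric complex. -/
theorem aomotoBetti_le_twHomDim {k : Type} [Field k] (L : Finset (Finset V)) (z w : V → k) (j : ℕ)
    (h : ∀ v, z v ≠ 0 → w v ≠ 0) :
    aomotoBetti k L w (j + 1) ≤ twHomDim k L z (j + 1) := by
  rw [aomotoBetti_succ, twHomDim_succ]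
  have h1 := rank_incidenceD_le L z w j h
  have h2 := rank_incidenceD_le L z w (j + 1) h
  omega

theorem twHomDim_le_aomotoBetti {k : Type} [Field k] (L : Finset (Finset V)) (z w : V → k) (j : ℕ)
    (h : ∀ v, w v ≠ 0 → z v ≠ 0) :
    twHomDim k L z (j + 1) ≤ aomotoBetti k L w (j + 1) := by
  rw [aomotoBetti_succ, twHomDim_succ]
  have h1 := rank_incidenceD_le L w z j h
  have h2 := rank_incidenceD_le L w z (j + 1) h
  omega

/-- characteristic varieties of a toric complex.  For `i, d ≥ 1`,
the locus of characters `ρ ∈ (k^×)^V` with `dim_k H_i(C_•(T_L, k_{γ(ρ)})) ≥ d`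
(where `γ(ρ)_v = ρ_v − 1`) is the union of the coordinate subtori `(k^×)^W` over
all `W ⊆ V` with `β_i(k⟨L⟩, W) ≥ d`. -/
theorem statement7 {V : Type} [Fintype V] [LinearOrder V] (k : Type) [Field k]
    (L : Finset (Finset V)) (hL : IsCx L) (hV : ∀ v : V, {v} ∈ L)
    (i d : ℕ) (hi : 1 ≤ i) (hd : 1 ≤ d) :
    ∀ ρ : V → k, (∀ v, ρ v ≠ 0) →
      (d ≤ twHomDim k L (fun v => ρ v - 1) i ↔
        ∃ W : Finset V, d ≤ aomotoBettiW k L W i ∧ ∀ v ∉ W, ρ v = 1) := by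
  intro ρ _
  obtain ⟨j, rfl⟩ : ∃ j, i = j + 1 := ⟨i - 1, by omega⟩
  classical
  constructor
  · intro h
    refine ⟨Finset.univ.filter fun v => ρ v ≠ 1,
      h.trans (twHomDim_le_aomotoBetti L _ _ j fun v hv => ?_), fun v hv => by simpa using hv⟩
    have : ρ v ≠ 1 := by simpa [zW] using hv
    exact sub_ne_zero.2 this
  · rintro ⟨W, hW, hρ⟩
    refine hW.trans (aomotoBetti_le_twHomDim L _ _ j fun v hv => ?_)
    have : v ∈ W := by
      by_contra hvW
      exact hv (sub_eq_zero.2 (hρ v hvW))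
    simp [zW, this]
end

section
/- Let k be a field and A a connected, locally finite, graded, graded-commutative k-algebra, generated in degree 1, with dim_k A¹ < ∞ and a² = 0 for all a ∈ A¹. Let a ∈ A¹ and set B = A/aA. If a ∉ ⋃_{i=1}^{r} R^i_1(A) for some r ≥ 1, then g_s(A) ≅ g_s(B) for all 2 ≤ s ≤ r+1, where g(A) = h(A)/h''(A) is the maximal metabelian quotient of the holonomy Lie algebra of A, with its grading by bracket length. -/
section HolonomySetup

variable (k : Type) [Field k] (A : Type) [Ring A] [Algebra k A]
variable (𝒜 : ℕ → Submodule k A) [GradedAlgebra 𝒜]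

/-- The product of two degree-one elements of a graded algebra, as an element of the
degree-two piece. -/
def mul11 (x y : ↥(𝒜 1)) : ↥(𝒜 2) :=
  ⟨(x : A) * (y : A), SetLike.mul_mem_graded x.2 y.2⟩

/-- Relations defining the holonomy Lie algebra `h(A)` inside the free Lie algebra
on (the underlying type of) `A_1 = (A¹)*`:  the linearity relations, identifying the
free Lie algebra on the type `A_1` with the free Lie algebra on the vector space
`A_1`, together with the image of the (dual of the) comultiplication
`∇ : A_2 → A_1 ∧ A_1`:  a sum `∑ [ξ_i, η_i]` is a relation precisely when the
alternating form `(x, y) ↦ ∑ (ξ_i(x)η_i(y) − ξ_i(y)η_i(x))` on `A¹` factors as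
`φ ∘ μ` for some `φ ∈ A_2`, where `μ : A¹ ⊗ A¹ → A²` is the multiplication. -/
def holoRels : Set (FreeLieAlgebra k (Module.Dual k ↥(𝒜 1))) :=
  {w | ∃ ξ η : Module.Dual k ↥(𝒜 1),
      w = FreeLieAlgebra.of k (ξ + η) - FreeLieAlgebra.of k ξ - FreeLieAlgebra.of k η} ∪
  {w | ∃ (c : k) (ξ : Module.Dual k ↥(𝒜 1)),
      w = FreeLieAlgebra.of k (c • ξ) - c • FreeLieAlgebra.of k ξ} ∪
  {w | ∃ (n : ℕ) (ξ η : Fin n → Module.Dual k ↥(𝒜 1)) (φ : Module.Dual k ↥(𝒜 2)),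
      (∀ x y : ↥(𝒜 1), (∑ i, (ξ i x * η i y - ξ i y * η i x)) = φ (mul11 k A 𝒜 x y)) ∧
      w = ∑ i, ⁅FreeLieAlgebra.of k (ξ i), FreeLieAlgebra.of k (η i)⁆}

/-- The holonomy Lie algebra `h(A) = Lie(A_1)/(im ∇)` of the graded algebra `A`. -/
abbrev Holo :=
  FreeLieAlgebra k (Module.Dual k ↥(𝒜 1)) ⧸
    LieSubmodule.lieSpan k (FreeLieAlgebra k (Module.Dual k ↥(𝒜 1))) (holoRels k A 𝒜)

/-- The maximal metabelian quotient `g(A) = h(A)/h''(A)` of the holonomy Lie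
algebra. -/
abbrev GLie := Holo k A 𝒜 ⧸ LieAlgebra.derivedSeries k (Holo k A 𝒜) 2

/-- The `s`-th graded piece `g_s(A)` of `g(A)` (for the bracket-length grading).
Since `g(A)` is generated in degree `1`, it equals `γ_s(g)/γ_{s+1}(g)`, realized here
as the image of the `(s-1)`-st term of the lower central series in the quotient of
`g(A)` by the `s`-th term. -/
noncomputable def gPiece (s : ℕ) :
    Submodule k
      ((GLie k A 𝒜) ⧸
        (LieModule.lowerCentralSeries k (GLie k A 𝒜) (GLie k A 𝒜) s).toSubmodule) :=
  Submodule.map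
    (Submodule.mkQ
      (LieModule.lowerCentralSeries k (GLie k A 𝒜) (GLie k A 𝒜) s).toSubmodule)
    ((LieModule.lowerCentralSeries k (GLie k A 𝒜) (GLie k A 𝒜) (s-1)).toSubmodule)

end HolonomySetup

namespace HolonomyTransfer

section Generic

variable {k : Type*} [Field k] {H H' : Type*} [LieRing H] [LieAlgebra k H]
  [LieRing H'] [LieAlgebra k H']

open LieModule LieAlgebra

/-- The Lie algebra map out of a quotient induced by a map killing the ideal. -/
def quotLift (I : LieIdeal k H) (f : H →ₗ⁅k⁆ H') (hf : ∀ x ∈ I, f x = 0) : H ⧸ I →ₗ⁅k⁆ H' where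
  toLinearMap := I.toSubmodule.liftQ (f : H →ₗ[k] H') hf
  map_lie' := by
    intro x y
    obtain ⟨x, rfl⟩ := LieSubmodule.Quotient.surjective_mk' I x
    obtain ⟨y, rfl⟩ := LieSubmodule.Quotient.surjective_mk' I y
    exact f.map_lie x y

/-- The quotient map by an ideal, as a map of Lie algebras. -/
def quotMk (I : LieIdeal k H) : H →ₗ⁅k⁆ H ⧸ I where
  toLinearMap := I.toSubmodule.mkQ
  map_lie' := by intro x y; rfl

theorem quotMk_surjective (I : LieIdeal k H) : Function.Surjective (quotMk I) :=
  LieSubmodule.Quotient.surjective_mk' I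

theorem quotMk_eq_zero {I : LieIdeal k H} {x : H} : quotMk I x = 0 ↔ x ∈ I :=
  LieSubmodule.Quotient.mk_eq_zero'

@[simp] theorem quotLift_quotMk (I : LieIdeal k H) (f : H →ₗ⁅k⁆ H') (hf : ∀ x ∈ I, f x = 0)
    (x : H) : quotLift I f hf (quotMk I x) = f x := rfl

theorem lie_mem_lcs_succ {n : ℕ} (x : H) {y : H} (hy : y ∈ lowerCentralSeries k H H n) :
    ⁅x, y⁆ ∈ lowerCentralSeries k H H (n + 1) := by
  rw [lowerCentralSeries_succ]
  exact LieSubmodule.lie_mem_lie (LieSubmodule.mem_top x) hy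

theorem lie_mem_lcs_one (x y : H) : ⁅x, y⁆ ∈ lowerCentralSeries k H H 1 :=
  lie_mem_lcs_succ x (n := 0) (by simp)

theorem lcs_succ_le {n : ℕ} {S : Submodule k H}
    (h : ∀ x : H, ∀ y ∈ lowerCentralSeries k H H n, ⁅x, y⁆ ∈ S) :
    (lowerCentralSeries k H H (n + 1)).toSubmodule ≤ S := by
  rw [lowerCentralSeries_succ, LieSubmodule.lieIdeal_oper_eq_linear_span', Submodule.span_le]
  rintro _ ⟨x, -, y, hy, rfl⟩
  exact h x y hy

theorem lie_lcs_one_mem {n : ℕ} {u v : H} (hu : u ∈ lowerCentralSeries k H H 1)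
    (hv : v ∈ lowerCentralSeries k H H n) : ⁅u, v⁆ ∈ lowerCentralSeries k H H (n + 2) := by
  let S : Submodule k H := (lowerCentralSeries k H H (n + 2)).toSubmodule.comap
    ((LieModule.toEnd k H H : H →ₗ[k] Module.End k H).flip v)
  refine lcs_succ_le (n := 0) (S := S) (fun x y _ => ?_) hu
  change ⁅⁅x, y⁆, v⁆ ∈ lowerCentralSeries k H H (n + 2)
  rw [lie_lie]
  exact sub_mem (lie_mem_lcs_succ _ (lie_mem_lcs_succ _ hv))
    (lie_mem_lcs_succ _ (lie_mem_lcs_succ _ hv))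

theorem map_lcs_le (f : H →ₗ⁅k⁆ H') (n : ℕ) :
    (lowerCentralSeries k H H n).toSubmodule.map (f : H →ₗ[k] H') ≤
      (lowerCentralSeries k H' H' n).toSubmodule :=
  lieModule_lcs_map_le (f := f) (g := (f : H →ₗ[k] H')) (fun x y => (f.map_lie x y).symm) n

theorem map_lcs_eq_of_surjective (f : H →ₗ⁅k⁆ H') (hf : Function.Surjective f) (n : ℕ) :
    (lowerCentralSeries k H H n).toSubmodule.map (f : H →ₗ[k] H') =
      (lowerCentralSeries k H' H' n).toSubmodule :=
  hf.lieModule_lcs_map_eq (f := f) (g := (f : H →ₗ[k] H')) (fun x y => (f.map_lie x y).symm) hf n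

section OneMoreGenerator

variable {f : H →ₗ⁅k⁆ H'} {t : H'}

theorem lie_generator_mem_map_lcs
    (ht : ∀ x, ⁅t, f x⁆ ∈ (lowerCentralSeries k H H 1).toSubmodule.map (f : H →ₗ[k] H'))
    (n : ℕ) : ∀ x ∈ lowerCentralSeries k H H n,
      ⁅t, f x⁆ ∈ (lowerCentralSeries k H H (n + 1)).toSubmodule.map (f : H →ₗ[k] H') := by
  induction n with
  | zero => exact fun x _ => ht x
  | succ n ih =>
    let S : Submodule k H :=
      ((lowerCentralSeries k H H (n + 2)).toSubmodule.map (f : H →ₗ[k] H')).comap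
        ((LieModule.toEnd k H' H' t) ∘ₗ (f : H →ₗ[k] H'))
    refine fun x hx => lcs_succ_le (S := S) (fun u v hv => ?_) hx
    change ⁅t, f ⁅u, v⁆⁆ ∈ (lowerCentralSeries k H H (n + 2)).toSubmodule.map (f : H →ₗ[k] H')
    rw [LieHom.map_lie, leibniz_lie]
    obtain ⟨u', hu', hu⟩ := ht u
    obtain ⟨v', hv', hv2⟩ := ih v hv
    refine add_mem ⟨⁅u', v⁆, lie_lcs_one_mem hu' hv, ?_⟩ ⟨⁅u, v'⁆, lie_mem_lcs_succ u hv', ?_⟩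
    · rw [← hu]; exact f.map_lie _ _
    · rw [← hv2]; exact f.map_lie _ _

theorem map_lcs_succ_eq (hgen : ∀ y, ∃ (c : k) (x : H), y = c • t + f x)
    (ht : ∀ x, ⁅t, f x⁆ ∈ (lowerCentralSeries k H H 1).toSubmodule.map (f : H →ₗ[k] H'))
    (n : ℕ) :
    (lowerCentralSeries k H H (n + 1)).toSubmodule.map (f : H →ₗ[k] H') =
      (lowerCentralSeries k H' H' (n + 1)).toSubmodule := by
  refine le_antisymm (map_lcs_le f _) ?_
  induction n with
  | zero =>
    refine lcs_succ_le fun x y _ => ?_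
    obtain ⟨c, x, rfl⟩ := hgen x
    obtain ⟨d, y, rfl⟩ := hgen y
    have h : ⁅c • t + f x, d • t + f y⁆ = c • ⁅t, f y⁆ - d • ⁅t, f x⁆ + f ⁅x, y⁆ := by
      simp only [lie_add, add_lie, lie_smul, smul_lie, lie_self, smul_zero, LieHom.map_lie]
      rw [← lie_skew t (f x)]
      module
    rw [h]
    exact add_mem (sub_mem (Submodule.smul_mem _ _ (ht y)) (Submodule.smul_mem _ _ (ht x)))
      ⟨_, lie_mem_lcs_one x y, rfl⟩
  | succ n ih =>
    refine lcs_succ_le fun x y hy => ?_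
    obtain ⟨c, x, rfl⟩ := hgen x
    obtain ⟨z, hz, rfl⟩ := ih hy
    rw [add_lie, smul_lie]
    exact add_mem (Submodule.smul_mem _ _ (lie_generator_mem_map_lcs ht _ z hz))
      ⟨_, lie_mem_lcs_succ x hz, f.map_lie _ _⟩

theorem derivedSeries_two_le (S : Submodule k H)
    (h : ∀ x ∈ lowerCentralSeries k H H 1, ∀ y ∈ lowerCentralSeries k H H 1, ⁅x, y⁆ ∈ S) :
    (derivedSeries k H 2).toSubmodule ≤ S := by
  change (⁅derivedSeries k H 1, derivedSeries k H 1⁆ : LieIdeal k H).toSubmodule ≤ S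
  rw [LieSubmodule.lieIdeal_oper_eq_linear_span', Submodule.span_le]
  rintro _ ⟨x, hx, y, hy, rfl⟩
  exact h x hx y hy

theorem lie_mem_derivedSeries_two {x y : H} (hx : x ∈ lowerCentralSeries k H H 1)
    (hy : y ∈ lowerCentralSeries k H H 1) : ⁅x, y⁆ ∈ derivedSeries k H 2 :=
  LieSubmodule.lie_mem_lie (I := derivedSeries k H 1) (N := derivedSeries k H 1) hx hy

theorem map_derivedSeries_two_le (f : H →ₗ⁅k⁆ H') :
    (derivedSeries k H 2).toSubmodule ≤
      (derivedSeries k H' 2).toSubmodule.comap (f : H →ₗ[k] H') := by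
  refine derivedSeries_two_le _ fun x hx y hy => ?_
  change f ⁅x, y⁆ ∈ derivedSeries k H' 2
  rw [LieHom.map_lie]
  exact lie_mem_derivedSeries_two (map_lcs_le f 1 ⟨x, hx, rfl⟩) (map_lcs_le f 1 ⟨y, hy, rfl⟩)

theorem derivedSeries_two_le_map (hgen : ∀ y, ∃ (c : k) (x : H), y = c • t + f x)
    (ht : ∀ x, ⁅t, f x⁆ ∈ (lowerCentralSeries k H H 1).toSubmodule.map (f : H →ₗ[k] H')) :
    (derivedSeries k H' 2).toSubmodule ≤
      (derivedSeries k H 2).toSubmodule.map (f : H →ₗ[k] H') := by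
  refine derivedSeries_two_le _ fun x hx y hy => ?_
  obtain ⟨x, hx', rfl⟩ := (map_lcs_succ_eq hgen ht 0).ge hx
  obtain ⟨y, hy', rfl⟩ := (map_lcs_succ_eq hgen ht 0).ge hy
  exact ⟨_, lie_mem_derivedSeries_two hx' hy', f.map_lie _ _⟩

end OneMoreGenerator

/-- The degree `n + 1` piece of the maximal metabelian quotient of a Lie algebra. -/
def metabelianPiece (k H : Type*) [Field k] [LieRing H] [LieAlgebra k H] (n m : ℕ) :
    Submodule k ((H ⧸ derivedSeries k H 2) ⧸
      (lowerCentralSeries k (H ⧸ derivedSeries k H 2) (H ⧸ derivedSeries k H 2) m).toSubmodule) :=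
  (lowerCentralSeries k (H ⧸ derivedSeries k H 2) (H ⧸ derivedSeries k H 2) n).toSubmodule.map
    (lowerCentralSeries k (H ⧸ derivedSeries k H 2) (H ⧸ derivedSeries k H 2) m).toSubmodule.mkQ

theorem nonempty_map_mkQ_equiv {M M' : Type*} [AddCommGroup M] [Module k M] [AddCommGroup M']
    [Module k M'] (f : M →ₗ[k] M') {P Q : Submodule k M} {P' Q' : Submodule k M'}
    (hP : P.map f = P') (hQ : Q ≤ Q'.comap f) (hinj : ∀ x ∈ P, f x ∈ Q' → x ∈ Q) :
    Nonempty (P.map Q.mkQ ≃ₗ[k] P'.map Q'.mkQ) := by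
  subst hP
  have hmap : ∀ x ∈ P.map Q.mkQ, Q.mapQ Q' f hQ x ∈ (P.map f).map Q'.mkQ := by
    rintro _ ⟨x, hx, rfl⟩
    exact ⟨f x, ⟨x, hx, rfl⟩, rfl⟩
  refine ⟨LinearEquiv.ofBijective ((Q.mapQ Q' f hQ).restrict hmap) ⟨?_, ?_⟩⟩
  · rw [← LinearMap.ker_eq_bot, LinearMap.ker_eq_bot']
    rintro ⟨_, x, hx, rfl⟩ h
    have h' : Q'.mkQ (f x) = 0 := congrArg Subtype.val h
    rw [Submodule.mkQ_apply, Submodule.Quotient.mk_eq_zero] at h'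
    ext
    exact (Submodule.Quotient.mk_eq_zero _).2 (hinj x hx h')
  · rintro ⟨_, _, ⟨x, hx, rfl⟩, rfl⟩
    exact ⟨⟨Q.mkQ x, x, hx, rfl⟩, rfl⟩

theorem nonempty_metabelianPiece_equiv {f : H →ₗ⁅k⁆ H'} {t : H'}
    (hgen : ∀ y, ∃ (c : k) (x : H), y = c • t + f x)
    (ht : ∀ x, ⁅t, f x⁆ ∈ (lowerCentralSeries k H H 1).toSubmodule.map (f : H →ₗ[k] H'))
    (n : ℕ) (hker : ∀ x, f x = 0 → x ∈ lowerCentralSeries k H H (n + 2)) :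
    Nonempty (metabelianPiece k H (n + 1) (n + 2) ≃ₗ[k] metabelianPiece k H' (n + 1) (n + 2)) := by
  let q := quotMk (derivedSeries k H 2)
  let q' := quotMk (derivedSeries k H' 2)
  let g : H ⧸ derivedSeries k H 2 →ₗ⁅k⁆ H' ⧸ derivedSeries k H' 2 :=
    quotLift _ (q'.comp f) fun x hx => quotMk_eq_zero.2 (map_derivedSeries_two_le f hx)
  have hq := map_lcs_eq_of_surjective q (quotMk_surjective _)
  have hq' := map_lcs_eq_of_surjective q' (quotMk_surjective _)
  refine nonempty_map_mkQ_equiv (g : _ →ₗ[k] _) (le_antisymm (map_lcs_le g _) ?_)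
    (Submodule.map_le_iff_le_comap.1 (map_lcs_le g _)) ?_
  · intro y hy
    obtain ⟨z, hz, rfl⟩ := (hq' _).ge hy
    obtain ⟨x, hx, rfl⟩ := (map_lcs_succ_eq hgen ht n).ge hz
    exact ⟨q x, (hq _).le ⟨x, hx, rfl⟩, rfl⟩
  · intro x hx hgx
    obtain ⟨x, hx, rfl⟩ := (hq _).ge hx
    obtain ⟨z, hz, hzx⟩ := (hq' _).ge hgx
    obtain ⟨y, hy, rfl⟩ := (map_lcs_succ_eq hgen ht (n + 1)).ge hz
    have h0 : q' (f x - f y) = 0 := by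
      rw [map_sub, sub_eq_zero]; exact hzx.symm
    obtain ⟨w, hw, hwx⟩ := derivedSeries_two_le_map hgen ht (quotMk_eq_zero.1 h0)
    have h1 : f (x - y - w) = 0 := by
      rw [map_sub, map_sub, sub_eq_zero]; exact hwx.symm
    have h2 : q x = q (x - y - w) + q y := by
      have h3 : q w = 0 := quotMk_eq_zero.2 hw
      rw [map_sub, map_sub, h3, sub_zero, sub_add_cancel]
    refine (congrArg (· ∈ lowerCentralSeries k (H ⧸ derivedSeries k H 2) _ (n + 2)) h2).mpr ?_
    exact add_mem ((hq _).le ⟨_, hker _ h1, rfl⟩) ((hq _).le ⟨_, hy, rfl⟩)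

end Generic

section Tangent

variable (k : Type*) [Field k] (N : Type*) [LieRing N] [LieAlgebra k N]

/-- The Lie algebra `N ⊗ k[ε]`, with elements `base + ε • tang`. -/
@[ext] structure TangentLie where
  /-- The component of order zero. -/
  base : N
  /-- The coefficient of `ε`. -/
  tang : N

variable {N}

namespace TangentLie

/-- The underlying pair of an element of `TangentLie N`. -/
def toProd : TangentLie N ≃ N × N where
  toFun x := (x.base, x.tang)
  invFun x := ⟨x.1, x.2⟩
  left_inv _ := rfl
  right_inv _ := rfl

instance : AddCommGroup (TangentLie N) := toProd.addCommGroup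

instance : Module k (TangentLie N) := toProd.module k

instance : Bracket (TangentLie N) (TangentLie N) where
  bracket x y := ⟨⁅x.base, y.base⁆, ⁅x.tang, y.base⁆ + ⁅x.base, y.tang⁆⟩

@[simp] theorem base_zero : (0 : TangentLie N).base = 0 := rfl
@[simp] theorem tang_zero : (0 : TangentLie N).tang = 0 := rfl
@[simp] theorem base_add (x y : TangentLie N) : (x + y).base = x.base + y.base := rfl
@[simp] theorem tang_add (x y : TangentLie N) : (x + y).tang = x.tang + y.tang := rfl
@[simp] theorem base_smul (c : k) (x : TangentLie N) : (c • x).base = c • x.base := rfl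
@[simp] theorem tang_smul (c : k) (x : TangentLie N) : (c • x).tang = c • x.tang := rfl
@[simp] theorem base_lie (x y : TangentLie N) : ⁅x, y⁆.base = ⁅x.base, y.base⁆ := rfl
@[simp] theorem tang_lie (x y : TangentLie N) :
    ⁅x, y⁆.tang = ⁅x.tang, y.base⁆ + ⁅x.base, y.tang⁆ := rfl

instance : LieRing (TangentLie N) where
  add_lie _ _ _ := by ext <;> simp; abel
  lie_add _ _ _ := by ext <;> simp; abel
  lie_self x := by
    ext
    · simp
    · change ⁅x.tang, x.base⁆ + ⁅x.base, x.tang⁆ = 0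
      rw [← lie_skew, neg_add_cancel]
  leibniz_lie x y z := by
    ext
    · simp
    · simp only [tang_lie, base_lie, tang_add, lie_add, add_lie]
      rw [leibniz_lie x.tang y.base z.base, leibniz_lie x.base y.tang z.base,
        leibniz_lie x.base y.base z.tang]
      abel

instance : LieAlgebra k (TangentLie N) where
  lie_smul _ _ _ := by ext <;> simp

/-- The order zero component, as a map of Lie algebras. -/
def baseHom : TangentLie N →ₗ⁅k⁆ N where
  toFun := base
  map_add' _ _ := rfl
  map_smul' _ _ := rfl
  map_lie' := rfl

/-- The coefficient of `ε`, as a linear map. -/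
def tangHom : TangentLie N →ₗ[k] N where
  toFun := tang
  map_add' _ _ := rfl
  map_smul' _ _ := rfl

/-- The pair of two linear maps, as a map to `TangentLie N`. -/
def prodHom {M : Type*} [AddCommGroup M] [Module k M] (p δ : M →ₗ[k] N) :
    M →ₗ[k] TangentLie N where
  toFun x := ⟨p x, δ x⟩
  map_add' _ _ := by ext <;> simp
  map_smul' _ _ := by ext <;> simp

end TangentLie

end Tangent

section Holonomy

variable {k : Type} [Field k] {A : Type} [Ring A] [Algebra k A]
  {𝒜 : ℕ → Submodule k A} [GradedAlgebra 𝒜]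
  {N : Type*} [LieRing N] [LieAlgebra k N]

/-- The multiplication `A¹ × A¹ → A²` as a bilinear map. -/
def mulBilin (𝒜 : ℕ → Submodule k A) [GradedAlgebra 𝒜] : 𝒜 1 →ₗ[k] 𝒜 1 →ₗ[k] 𝒜 2 :=
  LinearMap.mk₂ k (mul11 k A 𝒜)
    (fun x y z => Subtype.ext (add_mul (x : A) y z))
    (fun c x y => Subtype.ext (smul_mul_assoc c (x : A) (y : A)))
    (fun x y z => Subtype.ext (mul_add (x : A) y z))
    (fun c x y => Subtype.ext (mul_smul_comm c (x : A) (y : A)))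

/-- The pair of families `ξ, η` represents an element of the image of `∇`. -/
def IsRelation {ι : Type*} [Fintype ι] (ξ η : ι → Module.Dual k (𝒜 1))
    (φ : Module.Dual k (𝒜 2)) : Prop :=
  ∀ x y : 𝒜 1, ∑ i, (ξ i x * η i y - ξ i y * η i x) = φ (mulBilin 𝒜 x y)

/-- The universal linear map `A_1 → h(A)`. -/
noncomputable def holoOf (𝒜 : ℕ → Submodule k A) [GradedAlgebra 𝒜] :
    Module.Dual k (𝒜 1) →ₗ[k] Holo k A 𝒜 where
  toFun ξ := quotMk _ (FreeLieAlgebra.of k ξ)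
  map_add' ξ η := by
    rw [← map_add, ← sub_eq_zero, ← map_sub, quotMk_eq_zero, ← sub_sub]
    exact LieSubmodule.subset_lieSpan (Or.inl (Or.inl ⟨ξ, η, rfl⟩))
  map_smul' c ξ := by
    rw [RingHom.id_apply, ← map_smul, ← sub_eq_zero, ← map_sub, quotMk_eq_zero]
    exact LieSubmodule.subset_lieSpan (Or.inl (Or.inr ⟨c, ξ, rfl⟩))

theorem holoOf_relation {ι : Type*} [Fintype ι] {ξ η : ι → Module.Dual k (𝒜 1)}
    {φ : Module.Dual k (𝒜 2)} (h : IsRelation ξ η φ) :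
    ∑ i, ⁅holoOf 𝒜 (ξ i), holoOf 𝒜 (η i)⁆ = 0 := by
  let e := Fintype.equivFin ι
  rw [← e.symm.sum_comp]
  refine Eq.trans ?_ (quotMk_eq_zero.2 (LieSubmodule.subset_lieSpan (Or.inr
    ⟨_, ξ ∘ e.symm, η ∘ e.symm, φ, fun x y => ?_, rfl⟩)))
  · rw [map_sum]
    exact Finset.sum_congr rfl fun i _ => rfl
  · exact (e.symm.sum_comp _).trans (h x y)

/-- The Lie algebra map `h(A) → N` extending a linear map which respects the relations. -/
noncomputable def holoLift (p : Module.Dual k (𝒜 1) →ₗ[k] N)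
    (hp : ∀ (n : ℕ) (ξ η : Fin n → Module.Dual k (𝒜 1)) (φ : Module.Dual k (𝒜 2)),
      IsRelation ξ η φ → ∑ i, ⁅p (ξ i), p (η i)⁆ = 0) : Holo k A 𝒜 →ₗ⁅k⁆ N :=
  quotLift _ (FreeLieAlgebra.lift k p) fun x hx => by
    have h : LieSubmodule.lieSpan k _ (holoRels k A 𝒜) ≤ (FreeLieAlgebra.lift k p).ker := by
      rw [LieSubmodule.lieSpan_le]
      rintro _ ((⟨ξ, η, rfl⟩ | ⟨c, ξ, rfl⟩) | ⟨n, ξ, η, φ, h, rfl⟩)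
      · simp [FreeLieAlgebra.lift_of_apply]
      · simp [FreeLieAlgebra.lift_of_apply]
      · simpa [FreeLieAlgebra.lift_of_apply] using hp n ξ η φ h
    exact h hx

@[simp] theorem holoLift_holoOf (p : Module.Dual k (𝒜 1) →ₗ[k] N) (hp) (ξ) :
    holoLift (𝒜 := 𝒜) p hp (holoOf 𝒜 ξ) = p ξ :=
  FreeLieAlgebra.lift_of_apply (R := k) (p : _ → N) ξ

theorem holo_hom_ext {f g : Holo k A 𝒜 →ₗ⁅k⁆ N} (h : ∀ ξ, f (holoOf 𝒜 ξ) = g (holoOf 𝒜 ξ)) :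
    f = g := by
  have h' : f.comp (quotMk _) = g.comp (quotMk _) := FreeLieAlgebra.hom_ext h
  ext x
  obtain ⟨x, rfl⟩ := quotMk_surjective _ x
  exact LieHom.congr_fun h' x

theorem holo_induction (S : Submodule k (Holo k A 𝒜))
    (hlie : ∀ {x y : Holo k A 𝒜}, x ∈ S → y ∈ S → ⁅x, y⁆ ∈ S) (h : ∀ ξ, holoOf 𝒜 ξ ∈ S)
    (x : Holo k A 𝒜) : x ∈ S := by
  let L : LieSubalgebra k (Holo k A 𝒜) := { S with lie_mem' := hlie }
  let F : FreeLieAlgebra k (Module.Dual k (𝒜 1)) →ₗ⁅k⁆ L :=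
    FreeLieAlgebra.lift k fun ξ => ⟨holoOf 𝒜 ξ, h ξ⟩
  have hF : L.incl.comp F = quotMk _ := FreeLieAlgebra.hom_ext fun ξ => by
    simp [F, FreeLieAlgebra.lift_of_apply, holoOf]
  obtain ⟨x, rfl⟩ := quotMk_surjective _ x
  rw [← hF]
  exact (F x).2

theorem exists_derivation (P : Holo k A 𝒜 →ₗ⁅k⁆ N) (δ : Module.Dual k (𝒜 1) →ₗ[k] N)
    (hδ : ∀ (n : ℕ) (ξ η : Fin n → Module.Dual k (𝒜 1)) (φ : Module.Dual k (𝒜 2)),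
      IsRelation ξ η φ →
        ∑ i, (⁅δ (ξ i), P (holoOf 𝒜 (η i))⁆ + ⁅P (holoOf 𝒜 (ξ i)), δ (η i)⁆) = 0) :
    ∃ D : Holo k A 𝒜 →ₗ[k] N, (∀ ξ, D (holoOf 𝒜 ξ) = δ ξ) ∧
      ∀ x y, D ⁅x, y⁆ = ⁅D x, P y⁆ + ⁅P x, D y⁆ := by
  let F : Holo k A 𝒜 →ₗ⁅k⁆ TangentLie N :=
    holoLift (TangentLie.prodHom k ((P : _ →ₗ[k] N) ∘ₗ holoOf 𝒜) δ) fun n ξ η φ h => by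
      ext
      · change TangentLie.baseHom k _ = 0
        rw [map_sum]
        refine Eq.trans ?_ ((congrArg P (holoOf_relation h)).trans (map_zero P))
        rw [map_sum]
        exact Finset.sum_congr rfl fun i _ => (P.map_lie _ _).symm
      · change TangentLie.tangHom k _ = 0
        rw [map_sum]
        exact hδ n ξ η φ h
  have hF : (TangentLie.baseHom k).comp F = P := holo_hom_ext fun ξ => by
    rw [LieHom.comp_apply, holoLift_holoOf]; rfl
  refine ⟨TangentLie.tangHom k ∘ₗ F, fun ξ => ?_, fun x y => ?_⟩
  · change TangentLie.tangHom k (F _) = _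
    rw [holoLift_holoOf]; rfl
  · rw [← hF]
    exact congrArg (TangentLie.tangHom k) (F.map_lie x y)

end Holonomy

section AlternatingSums

variable {k : Type*} [Field k] {N : Type*} [LieRing N] [LieAlgebra k N] {ι : Type*} [Fintype ι]
  [LinearOrder ι]

/-- The sum `∑ f i j • ⁅x i, x j⁆` over all `i < j`. -/
def altBracket (x : ι → N) : (ι → ι → k) →ₗ[k] N where
  toFun f := ∑ i, ∑ j, (if i < j then f i j else 0) • ⁅x i, x j⁆
  map_add' f g := by
    simp only [← Finset.sum_add_distrib, ← add_smul]
    refine Finset.sum_congr rfl fun i _ => Finset.sum_congr rfl fun j _ => ?_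
    split_ifs <;> simp
  map_smul' c f := by
    simp only [RingHom.id_apply, Finset.smul_sum, smul_smul, mul_ite, mul_zero]
    rfl

theorem altBracket_apply (x : ι → N) (f : ι → ι → k) :
    altBracket x f = ∑ i, ∑ j, (if i < j then f i j else 0) • ⁅x i, x j⁆ := rfl

theorem sum_smul_lie_eq_altBracket (x : ι → N) (g : ι → ι → k) :
    ∑ i, ∑ j, g i j • ⁅x i, x j⁆ = altBracket x fun i j => g i j - g j i := by
  have h : ∀ i j, g i j • ⁅x i, x j⁆ = (if i < j then g i j else 0) • ⁅x i, x j⁆ -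
      (if j < i then g i j else 0) • ⁅x j, x i⁆ := by
    intro i j
    rcases lt_trichotomy i j with h | rfl | h
    · simp [h, h.not_gt]
    · simp
    · simp only [h.not_gt, h, if_true, if_false, zero_smul, zero_sub]
      rw [← smul_neg, lie_skew]
  have hfg : (fun i j => g i j - g j i) = g - fun i j => g j i := rfl
  rw [hfg, map_sub, altBracket_apply, altBracket_apply]
  simp_rw [h, Finset.sum_sub_distrib]
  congr 1
  exact Finset.sum_comm

theorem altBracket_lie_mem (x : ι → N) (f : ι → ι → k) :
    altBracket x f ∈ LieModule.lowerCentralSeries k N N 1 :=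
  sum_mem fun _ _ => sum_mem fun _ _ => SMulMemClass.smul_mem _ (lie_mem_lcs_one _ _)

theorem sum_lie_altBracket_eq_zero (x : ι → N) (f : ι → ι → ι → k)
    (h12 : ∀ i j, f i i j = 0) (h12' : ∀ i j l, f i j l = -f j i l)
    (h23 : ∀ i j, f i j j = 0) (h23' : ∀ i j l, f i j l = -f i l j) :
    ∑ i, ⁅x i, altBracket x (f i)⁆ = 0 := by
  let h : ι → ι → ι → k := fun i j l => if i < j ∧ j < l then f i j l else 0
  have key : ∀ i j l, (if j < l then f i j l else 0) = h i j l - h j i l + h j l i := by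
    intro i j l
    dsimp only [h]
    by_cases hjl : j < l
    · rcases lt_trichotomy i j with hij | rfl | hij
      · simp [hjl, hij, hij.not_gt, (hij.trans hjl).not_gt]
      · simp [hjl, h12, hjl.not_gt]
      · rcases lt_trichotomy i l with hil | rfl | hil
        · simp [hjl, hij, hij.not_gt, hil, hil.not_gt, h12' i j l]
        · simp [hjl, hij.not_gt, h12' i j i, h23]
        · simp [hjl, hij, hij.not_gt, hil, hil.not_gt, h12' i j l, h23' j i l]
    · have h1 : ¬ (j < i ∧ i < l) := fun h => hjl (h.1.trans h.2)
      simp [hjl, h1]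
  have e1 : ∑ i, ∑ j, ∑ l, h j i l • ⁅x i, ⁅x j, x l⁆⁆ =
      ∑ i, ∑ j, ∑ l, h i j l • ⁅x j, ⁅x i, x l⁆⁆ := Finset.sum_comm
  have e2 : ∑ i, ∑ j, ∑ l, h j l i • ⁅x i, ⁅x j, x l⁆⁆ =
      ∑ i, ∑ j, ∑ l, h i j l • ⁅x l, ⁅x i, x j⁆⁆ := by
    rw [Finset.sum_comm]
    exact Finset.sum_congr rfl fun i _ => Finset.sum_comm
  simp_rw [altBracket_apply, lie_sum, lie_smul, key, add_smul, sub_smul, Finset.sum_add_distrib,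
    Finset.sum_sub_distrib, e1, e2, ← Finset.sum_sub_distrib, ← Finset.sum_add_distrib, ← smul_sub,
    ← smul_add]
  refine Finset.sum_eq_zero fun i _ => Finset.sum_eq_zero fun j _ => Finset.sum_eq_zero fun l _ => ?_
  rw [leibniz_lie (x i) (x j) (x l), ← lie_skew (x l) ⁅x i, x j⁆]
  simp

end AlternatingSums

section Relations

variable {k : Type*} [Field k] {N : Type*} [LieRing N] [LieAlgebra k N] {V : Type*} [AddCommGroup V] [Module k V]
  {ι : Type*} [Fintype ι]

theorem sum_lie_eq_sum_basis (b : Module.Basis ι k V) (p q : Module.Dual k V →ₗ[k] N)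
    {m : Type*} [Fintype m] (ξ η : m → Module.Dual k V) :
    ∑ l, ⁅p (ξ l), q (η l)⁆ =
      ∑ i, ∑ j, (∑ l, ξ l (b i) * η l (b j)) • ⁅p (b.coord i), q (b.coord j)⁆ := by
  have h : ∀ l, ⁅p (ξ l), q (η l)⁆ =
      ∑ i, ∑ j, (ξ l (b i) * η l (b j)) • ⁅p (b.coord i), q (b.coord j)⁆ := by
    intro l
    conv_lhs => rw [← b.sum_dual_apply_smul_coord (ξ l), ← b.sum_dual_apply_smul_coord (η l)]
    simp only [map_sum, map_smul, sum_lie, lie_sum, smul_lie, lie_smul,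
      Finset.smul_sum, smul_smul]
    rw [Finset.sum_comm]
    exact Finset.sum_congr rfl fun i _ => Finset.sum_congr rfl fun j _ => by rw [mul_comm]
  simp_rw [h, Finset.sum_smul]
  rw [Finset.sum_comm]
  exact Finset.sum_congr rfl fun i _ => Finset.sum_comm

theorem sum_lie_eq_altBracket [LinearOrder ι] (b : Module.Basis ι k V) (p : Module.Dual k V →ₗ[k] N)
    {m : Type*} [Fintype m] (ξ η : m → Module.Dual k V) :
    ∑ l, ⁅p (ξ l), p (η l)⁆ = altBracket (fun i => p (b.coord i))
      fun i j => ∑ l, (ξ l (b i) * η l (b j) - ξ l (b j) * η l (b i)) := by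
  rw [sum_lie_eq_sum_basis b, sum_smul_lie_eq_altBracket]
  simp_rw [← Finset.sum_sub_distrib]

theorem sum_lie_add_lie_eq (b : Module.Basis ι k V) (p δ : Module.Dual k V →ₗ[k] N)
    {m : Type*} [Fintype m] (ξ η : m → Module.Dual k V) :
    ∑ l, (⁅δ (ξ l), p (η l)⁆ + ⁅p (ξ l), δ (η l)⁆) =
      ∑ i, ∑ j, (∑ l, (ξ l (b i) * η l (b j) - ξ l (b j) * η l (b i))) •
        ⁅p (b.coord i), δ (b.coord j)⁆ := by
  have h : ∀ l, ⁅δ (ξ l), p (η l)⁆ = -⁅p (η l), δ (ξ l)⁆ := fun l => (lie_skew _ _).symm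
  simp_rw [h, neg_add_eq_sub, Finset.sum_sub_distrib, sum_lie_eq_sum_basis b p δ, sub_smul,
    Finset.sum_sub_distrib, mul_comm (ξ _ _) (η _ _)]

end Relations

section Transfer

theorem exists_comp_eq_of_ker_le {k M M' M'' : Type*} [Field k] [AddCommGroup M] [Module k M]
    [AddCommGroup M'] [Module k M'] [AddCommGroup M''] [Module k M''] (f : M →ₗ[k] M')
    (g : M →ₗ[k] M'') (h : ∀ x, f x = 0 → g x = 0) : ∃ u : M' →ₗ[k] M'', ∀ x, u (f x) = g x := by
  obtain ⟨u, hu⟩ := ((LinearMap.ker f).liftQ g h ∘ₗ f.quotKerEquivRange.symm.toLinearMap).exists_extend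
  refine ⟨u, fun x => ?_⟩
  have h1 : f.quotKerEquivRange.symm ⟨f x, x, rfl⟩ = (LinearMap.ker f).mkQ x := by
    rw [LinearEquiv.symm_apply_eq]; rfl
  refine (LinearMap.congr_fun hu ⟨f x, x, rfl⟩).trans ?_
  rw [LinearMap.comp_apply, LinearEquiv.coe_coe, h1]
  rfl

theorem sum_coord_eq_of_alternating {k V ι : Type*} [Field k] [AddCommGroup V] [Module k V]
    [Fintype ι] [LinearOrder ι] (b : Module.Basis ι k V) (ω : V →ₗ[k] V →ₗ[k] k)
    (hω : ∀ x, ω x x = 0) (x y : V) :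
    ∑ i, ∑ j, (if i < j then ω (b i) (b j) else 0) *
      (b.coord i x * b.coord j y - b.coord i y * b.coord j x) = ω x y := by
  have hneg : ∀ x y, ω y x = -ω x y := fun x y => by
    have h := hω (x + y)
    simp only [map_add, LinearMap.add_apply, hω, zero_add, add_zero] at h
    exact eq_neg_of_add_eq_zero_left h
  have hsplit : ∀ i j, ω (b i) (b j) =
      (if i < j then ω (b i) (b j) else 0) - (if j < i then ω (b j) (b i) else 0) := by
    intro i j
    rcases lt_trichotomy i j with h | rfl | h
    · simp [h, h.not_gt]
    · simp [hω]
    · simp [h, h.not_gt, hneg (b j) (b i)]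
  obtain ⟨g, hg⟩ : ∃ g : ι → ι → k, ∀ i j, (if i < j then ω (b i) (b j) else 0) = g i j :=
    ⟨_, fun _ _ => rfl⟩
  simp only [hg] at hsplit ⊢
  have hxy : ω x y = ∑ i, ∑ j, ω (b i) (b j) * (b.coord i x * b.coord j y) := by
    conv_lhs => rw [← b.sum_repr x, ← b.sum_repr y]
    simp only [map_sum, map_smul, LinearMap.sum_apply, LinearMap.smul_apply, smul_eq_mul,
      Finset.mul_sum, Module.Basis.coord_apply]
    rw [Finset.sum_comm]
    exact Finset.sum_congr rfl fun i _ => Finset.sum_congr rfl fun j _ => by ring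
  rw [hxy]
  simp only [hsplit, sub_mul, mul_sub, Finset.sum_sub_distrib]
  congr 1
  rw [Finset.sum_comm]
  exact Finset.sum_congr rfl fun i _ => Finset.sum_congr rfl fun j _ => by ring

variable {k : Type} [Field k] {A B : Type} [Ring A] [Algebra k A] [Ring B] [Algebra k B]

/-- The low degree part of a quotient map `A → A/aA`, with splittings. -/
structure TransferData (𝒜 : ℕ → Submodule k A) [GradedAlgebra 𝒜]
    (ℬ : ℕ → Submodule k B) [GradedAlgebra ℬ] where
  /-- The element by which one divides. -/
  a : 𝒜 1
  /-- The quotient map in degree one. -/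
  π₁ : 𝒜 1 →ₗ[k] ℬ 1
  /-- The quotient map in degree two. -/
  π₂ : 𝒜 2 →ₗ[k] ℬ 2
  /-- A linear section of `π₁`. -/
  σ : ℬ 1 →ₗ[k] 𝒜 1
  /-- The coordinate along `a` which vanishes on the image of `σ`. -/
  t : Module.Dual k (𝒜 1)
  /-- A partial inverse of multiplication by `a`. -/
  θ : 𝒜 2 →ₗ[k] ℬ 1
  mul_self : ∀ x : 𝒜 1, (x * x : A) = 0
  π₂_mul : ∀ x y, π₂ (mulBilin 𝒜 x y) = mulBilin ℬ (π₁ x) (π₁ y)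
  π₁_a : π₁ a = 0
  π₁_σ : ∀ u, π₁ (σ u) = u
  t_a : t a = 1
  t_σ : ∀ u, t (σ u) = 0
  decomp : ∀ x, x = t x • a + σ (π₁ x)
  θ_mul : ∀ x, θ (mulBilin 𝒜 a x) = π₁ x
  exists_factor : ∀ χ : Module.Dual k (𝒜 2), (∀ x, χ (mulBilin 𝒜 a x) = 0) →
    ∃ φ : Module.Dual k (ℬ 2), ∀ x, φ (π₂ x) = χ x

namespace TransferData

variable {𝒜 : ℕ → Submodule k A} [GradedAlgebra 𝒜] {ℬ : ℕ → Submodule k B} [GradedAlgebra ℬ]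
  (T : TransferData 𝒜 ℬ)

include T

theorem mulBilin_self (x : 𝒜 1) : mulBilin 𝒜 x x = 0 := Subtype.ext (T.mul_self x)

theorem mul_anticomm (x y : 𝒜 1) : (x * y : A) = -(y * x) := by
  have h := T.mul_self (x + y)
  push_cast at h
  simp only [mul_add, add_mul, T.mul_self, zero_add, add_zero] at h
  exact eq_neg_of_add_eq_zero_right h

theorem mulBilin_anticomm (x y : 𝒜 1) : mulBilin 𝒜 x y = -mulBilin 𝒜 y x :=
  Subtype.ext (T.mul_anticomm x y)

theorem mulBilin_quotient_self (u : ℬ 1) : mulBilin ℬ u u = 0 := by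
  rw [← T.π₁_σ u, ← T.π₂_mul, T.mulBilin_self, map_zero]

/-- The contraction of `χ ∈ A_2` with `a`, restricted to the image of `σ`. -/
def contr : Module.Dual k (𝒜 2) →ₗ[k] Module.Dual k (ℬ 1) where
  toFun χ := χ ∘ₗ mulBilin 𝒜 T.a ∘ₗ T.σ
  map_add' _ _ := rfl
  map_smul' _ _ := rfl

theorem contr_apply (χ u) : T.contr χ u = χ (mulBilin 𝒜 T.a (T.σ u)) := rfl

theorem mul_a_eq (x : 𝒜 1) : mulBilin 𝒜 T.a x = mulBilin 𝒜 T.a (T.σ (T.π₁ x)) := by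
  conv_lhs => rw [T.decomp x]
  rw [map_add, map_smul, T.mulBilin_self, smul_zero, zero_add]

variable {N : Type*} [LieRing N] [LieAlgebra k N] {ι : Type*} [Fintype ι] [LinearOrder ι]
  (b : Module.Basis ι k (ℬ 1)) (p : Module.Dual k (ℬ 1) →ₗ[k] N)

/-- The values on `B_1` of the derivation describing the action of `t`. -/
noncomputable def deriv : Module.Dual k (ℬ 1) →ₗ[k] N :=
  -(altBracket (fun i => p (b.coord i)) ∘ₗ
    { toFun := fun w i j => w (T.θ (mulBilin 𝒜 (T.σ (b i)) (T.σ (b j))))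
      map_add' := fun _ _ => rfl
      map_smul' := fun _ _ => rfl })

theorem deriv_apply (w) : T.deriv b p w = -altBracket (fun i => p (b.coord i))
    fun i j => w (T.θ (mulBilin 𝒜 (T.σ (b i)) (T.σ (b j)))) := rfl

theorem deriv_mem_lcs (w) : T.deriv b p w ∈ LieModule.lowerCentralSeries k N N 1 :=
  neg_mem (altBracket_lie_mem _ _)

section

variable (hp : ∀ φ : Module.Dual k (ℬ 2),
  altBracket (fun i => p (b.coord i)) (fun i j => φ (mulBilin ℬ (b i) (b j))) = 0)

include hp

theorem altBracket_eq_neg_deriv (χ : Module.Dual k (𝒜 2)) :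
    altBracket (fun i => p (b.coord i)) (fun i j => χ (mulBilin 𝒜 (T.σ (b i)) (T.σ (b j)))) =
      -T.deriv b p (T.contr χ) := by
  obtain ⟨φ, hφ⟩ := T.exists_factor (χ - T.contr χ ∘ₗ T.θ) fun x => by
    rw [LinearMap.sub_apply, LinearMap.comp_apply, T.θ_mul, contr_apply, ← mul_a_eq, sub_self]
  rw [deriv_apply, neg_neg, ← sub_eq_zero, ← map_sub, ← hp φ]
  congr 1
  funext i j
  have h := hφ (mulBilin 𝒜 (T.σ (b i)) (T.σ (b j)))
  rw [T.π₂_mul, T.π₁_σ, T.π₁_σ] at h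
  exact h.symm

theorem sum_lie_deriv_eq_zero (φ : Module.Dual k (ℬ 2)) (ψ : Module.Dual k A)
    (hψ : ∀ x : 𝒜 2, ψ (T.a * x) = φ (T.π₂ x)) :
    ∑ i, ∑ j, φ (mulBilin ℬ (b i) (b j)) • ⁅p (b.coord i), T.deriv b p (b.coord j)⁆ = 0 := by
  let E : ι → A := fun i => T.σ (b i)
  have hE : ∀ i, E i * E i = 0 := fun i => T.mul_self _
  have hE' : ∀ i j, E i * E j = -(E j * E i) := fun i j => T.mul_anticomm _ _
  have h := sum_lie_altBracket_eq_zero (fun i => p (b.coord i))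
    (fun i j l => ψ (E i * (E j * E l)))
    (fun i j => by rw [← mul_assoc, hE, zero_mul, map_zero])
    (fun i j l => by rw [← mul_assoc, hE', neg_mul, map_neg, mul_assoc])
    (fun i j => by rw [hE, mul_zero, map_zero])
    (fun i j l => by rw [hE', mul_neg, map_neg])
  rw [← h]
  refine Finset.sum_congr rfl fun i _ => ?_
  let χ : Module.Dual k (𝒜 2) := ψ ∘ₗ LinearMap.mulLeft k (E i) ∘ₗ (𝒜 2).subtype
  have hχ : -T.contr χ = φ ∘ₗ mulBilin ℬ (b i) := by
    ext u
    have h1 : ψ (T.a * (mulBilin 𝒜 (T.σ (b i)) (T.σ u) : 𝒜 2)) = φ (mulBilin ℬ (b i) u) := by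
      rw [hψ, T.π₂_mul, T.π₁_σ, T.π₁_σ]
    have h2 : T.contr χ u = ψ (E i * (T.a * T.σ u)) := rfl
    rw [LinearMap.neg_apply, h2, ← mul_assoc, T.mul_anticomm, neg_mul, map_neg, neg_neg, mul_assoc]
    exact h1
  have h3 := T.altBracket_eq_neg_deriv b p hp χ
  rw [← map_neg, hχ, ← b.sum_dual_apply_smul_coord (φ ∘ₗ mulBilin ℬ (b i)), map_sum] at h3
  refine Eq.trans ?_ (congrArg (fun z => ⁅p (b.coord i), z⁆) h3.symm)
  simp only [map_smul, lie_sum, lie_smul, LinearMap.comp_apply]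

end

theorem altBracket_holoOf_eq_zero (φ : Module.Dual k (ℬ 2)) :
    altBracket (fun i => holoOf ℬ (b.coord i)) (fun i j => φ (mulBilin ℬ (b i) (b j))) = 0 := by
  have h : IsRelation (𝒜 := ℬ)
      (fun ij : ι × ι => (if ij.1 < ij.2 then φ (mulBilin ℬ (b ij.1) (b ij.2)) else 0) •
        b.coord ij.1) (fun ij => b.coord ij.2) φ := fun x y => by
    have h := sum_coord_eq_of_alternating b ((mulBilin ℬ).compr₂ φ)
      (fun x => by rw [LinearMap.compr₂_apply, T.mulBilin_quotient_self, map_zero]) x y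
    rw [LinearMap.compr₂_apply] at h
    rw [← h, Fintype.sum_prod_type]
    refine Finset.sum_congr rfl fun i _ => Finset.sum_congr rfl fun j _ => ?_
    simp only [LinearMap.smul_apply, smul_eq_mul, LinearMap.compr₂_apply]
    ring
  rw [← holoOf_relation h, Fintype.sum_prod_type, altBracket_apply]
  simp only [map_smul, smul_lie]

theorem altBracket_map_holoOf_eq_zero (P : Holo k B ℬ →ₗ⁅k⁆ N) (φ : Module.Dual k (ℬ 2)) :
    altBracket (fun i => P (holoOf ℬ (b.coord i))) (fun i j => φ (mulBilin ℬ (b i) (b j))) = 0 := by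
  have h := congrArg P (T.altBracket_holoOf_eq_zero b φ)
  rw [map_zero] at h
  rw [← h]
  simp only [altBracket_apply, map_sum, map_smul, LieHom.map_lie]

/-- The map `h(B) → h(A)` dual to the quotient map. -/
noncomputable def holoMap : Holo k B ℬ →ₗ⁅k⁆ Holo k A 𝒜 :=
  holoLift (holoOf 𝒜 ∘ₗ T.π₁.dualMap) fun n ξ η φ h =>
    holoOf_relation (φ := φ ∘ₗ T.π₂) (ξ := fun i => T.π₁.dualMap (ξ i))
      (η := fun i => T.π₁.dualMap (η i)) fun x y => by
      rw [LinearMap.comp_apply, T.π₂_mul]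
      exact h _ _

theorem holoMap_holoOf (w) : T.holoMap (holoOf ℬ w) = holoOf 𝒜 (w ∘ₗ T.π₁) :=
  holoLift_holoOf _ _ _

include b in
theorem lie_t_holoMap_holoOf_mem (w) : ⁅holoOf 𝒜 T.t, T.holoMap (holoOf ℬ w)⁆ ∈
    (LieModule.lowerCentralSeries k (Holo k B ℬ) (Holo k B ℬ) 1).toSubmodule.map
      (T.holoMap : Holo k B ℬ →ₗ[k] Holo k A 𝒜) := by
  let χ : Module.Dual k (𝒜 2) := w ∘ₗ T.θ
  let g : ι → ι → k := fun i j => if i < j then χ (mulBilin 𝒜 (T.σ (b i)) (T.σ (b j))) else 0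
  have h : IsRelation
      (fun o : Option (ι × ι) => o.elim T.t fun ij => g ij.1 ij.2 • b.coord ij.1 ∘ₗ T.π₁)
      (fun o => o.elim (w ∘ₗ T.π₁) fun ij => b.coord ij.2 ∘ₗ T.π₁) χ := fun x y => by
    have h := sum_coord_eq_of_alternating b ((mulBilin 𝒜).compr₂ χ |>.compl₁₂ T.σ T.σ)
      (fun x => by
        rw [LinearMap.compl₁₂_apply, LinearMap.compr₂_apply, T.mulBilin_self, map_zero])
      (T.π₁ x) (T.π₁ y)
    have hxy : χ (mulBilin 𝒜 x y) = T.t x * w (T.π₁ y) - T.t y * w (T.π₁ x) +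
        χ (mulBilin 𝒜 (T.σ (T.π₁ x)) (T.σ (T.π₁ y))) := by
      conv_lhs => rw [T.decomp x, T.decomp y]
      simp only [map_add, map_smul, LinearMap.add_apply, LinearMap.smul_apply, T.mulBilin_self,
        T.mulBilin_anticomm (T.σ _) T.a, χ, LinearMap.comp_apply, map_neg, T.θ_mul, T.π₁_σ,
        smul_eq_mul, map_zero]
      ring
    rw [hxy, Fintype.sum_option, Fintype.sum_prod_type]
    congr 1
    refine Eq.trans ?_ h
    refine Finset.sum_congr rfl fun i _ => Finset.sum_congr rfl fun j _ => ?_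
    change g i j * _ * _ - g i j * _ * _ = g i j * _
    rw [mul_sub, ← mul_assoc, ← mul_assoc]
    rfl
  have h0 := holoOf_relation h
  rw [Fintype.sum_option] at h0
  have h1 : ⁅holoOf 𝒜 T.t, holoOf 𝒜 (w ∘ₗ T.π₁)⁆ = _ := eq_neg_of_add_eq_zero_left h0
  rw [holoMap_holoOf, h1]
  refine neg_mem (sum_mem fun ij _ => ?_)
  refine ⟨⁅holoOf ℬ (g ij.1 ij.2 • b.coord ij.1), holoOf ℬ (b.coord ij.2)⁆,
    lie_mem_lcs_one _ _, ?_⟩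
  change T.holoMap _ = _
  rw [LieHom.map_lie, holoMap_holoOf, holoMap_holoOf]
  rfl

include b in
theorem lie_t_holoMap_mem (x : Holo k B ℬ) : ⁅holoOf 𝒜 T.t, T.holoMap x⁆ ∈
    (LieModule.lowerCentralSeries k (Holo k B ℬ) (Holo k B ℬ) 1).toSubmodule.map
      (T.holoMap : Holo k B ℬ →ₗ[k] Holo k A 𝒜) := by
  let S : Submodule k (Holo k B ℬ) :=
    ((LieModule.lowerCentralSeries k (Holo k B ℬ) (Holo k B ℬ) 1).toSubmodule.map
      (T.holoMap : Holo k B ℬ →ₗ[k] Holo k A 𝒜)).comap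
      (LieModule.toEnd k (Holo k A 𝒜) (Holo k A 𝒜) (holoOf 𝒜 T.t) ∘ₗ
        (T.holoMap : Holo k B ℬ →ₗ[k] Holo k A 𝒜))
  have hlie : ∀ {x y : Holo k B ℬ}, x ∈ S → y ∈ S → ⁅x, y⁆ ∈ S := by
    intro x y hx hy
    obtain ⟨x', -, hx⟩ := hx
    obtain ⟨y', -, hy⟩ := hy
    change T.holoMap x' = ⁅holoOf 𝒜 T.t, T.holoMap x⁆ at hx
    change T.holoMap y' = ⁅holoOf 𝒜 T.t, T.holoMap y⁆ at hy
    refine ⟨⁅x', y⁆ + ⁅x, y'⁆, add_mem (lie_mem_lcs_one _ _) (lie_mem_lcs_one _ _), ?_⟩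
    change T.holoMap _ = ⁅holoOf 𝒜 T.t, T.holoMap ⁅x, y⁆⁆
    rw [map_add, LieHom.map_lie, LieHom.map_lie, LieHom.map_lie, leibniz_lie, hx, hy]
  exact holo_induction S hlie (T.lie_t_holoMap_holoOf_mem b) x

include b in
theorem exists_smul_t_add_holoMap (y : Holo k A 𝒜) :
    ∃ (c : k) (x : Holo k B ℬ), y = c • holoOf 𝒜 T.t + T.holoMap x := by
  let S : Submodule k (Holo k A 𝒜) :=
    k ∙ holoOf 𝒜 T.t ⊔ LinearMap.range (T.holoMap : Holo k B ℬ →ₗ[k] Holo k A 𝒜)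
  have hS : ∀ z, z ∈ S ↔ ∃ (c : k) (x : Holo k B ℬ), z = c • holoOf 𝒜 T.t + T.holoMap x := by
    intro z
    simp only [S, Submodule.mem_sup, Submodule.mem_span_singleton, LinearMap.mem_range]
    constructor
    · rintro ⟨_, ⟨c, rfl⟩, _, ⟨x, rfl⟩, rfl⟩
      exact ⟨c, x, rfl⟩
    · rintro ⟨c, x, rfl⟩
      exact ⟨_, ⟨c, rfl⟩, _, ⟨x, rfl⟩, rfl⟩
  have hlie : ∀ {x y : Holo k A 𝒜}, x ∈ S → y ∈ S → ⁅x, y⁆ ∈ S := by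
    intro x y hx hy
    obtain ⟨c, x, rfl⟩ := (hS x).1 hx
    obtain ⟨d, y, rfl⟩ := (hS y).1 hy
    obtain ⟨x', -, hx'⟩ := T.lie_t_holoMap_mem b x
    obtain ⟨y', -, hy'⟩ := T.lie_t_holoMap_mem b y
    change T.holoMap x' = _ at hx'
    change T.holoMap y' = _ at hy'
    refine (hS _).2 ⟨0, c • y' - d • x' + ⁅x, y⁆, ?_⟩
    simp only [lie_add, add_lie, lie_smul, smul_lie, lie_self, smul_zero, zero_smul, map_add,
      map_sub, map_smul, hx', hy', LieHom.map_lie]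
    rw [← lie_skew (holoOf 𝒜 T.t) (T.holoMap x)]
    module
  refine (hS y).1 (holo_induction S hlie (fun η => ?_) y)
  refine (hS _).2 ⟨η T.a, holoOf ℬ (η ∘ₗ T.σ), ?_⟩
  rw [holoMap_holoOf, ← map_smul, ← map_add]
  congr 1
  ext x
  conv_lhs => rw [T.decomp x]
  simp [mul_comm]

/-- A derivation of a quotient of `h(B)` extending `deriv` detects the kernel of `holoMap`. -/
theorem map_eq_zero_of_holoMap_eq_zero (P : Holo k B ℬ →ₗ⁅k⁆ N) (D : LieDerivation k N N)
    (hD : ∀ w, D (P (holoOf ℬ w)) =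
      T.deriv b ((P : Holo k B ℬ →ₗ[k] N) ∘ₗ holoOf ℬ) w)
    {x : Holo k B ℬ} (hx : T.holoMap x = 0) : P x = 0 := by
  let p : Module.Dual k (ℬ 1) →ₗ[k] N := (P : Holo k B ℬ →ₗ[k] N) ∘ₗ holoOf ℬ
  have hp : ∀ φ : Module.Dual k (ℬ 2),
      altBracket (fun i => p (b.coord i)) (fun i j => φ (mulBilin ℬ (b i) (b j))) = 0 :=
    T.altBracket_map_holoOf_eq_zero b P
  let G := LieAlgebra.SemiDirectSum N (LieDerivation k N N)
    (LieHom.id : LieDerivation k N N →ₗ⁅k⁆ LieDerivation k N N)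
  let q : Module.Dual k (𝒜 1) →ₗ[k] G :=
    { toFun := fun η => ⟨p (η ∘ₗ T.σ), η T.a • D⟩
      map_add' := fun ξ η => LieAlgebra.SemiDirectSum.ext
        (map_add p (ξ ∘ₗ T.σ) (η ∘ₗ T.σ)) (add_smul (ξ T.a) (η T.a) D)
      map_smul' := fun c η => LieAlgebra.SemiDirectSum.ext
        (map_smul p c (η ∘ₗ T.σ)) (mul_smul c (η T.a) D) }
  have hq : ∀ (n : ℕ) (ξ η : Fin n → Module.Dual k (𝒜 1)) (χ : Module.Dual k (𝒜 2)),
      IsRelation ξ η χ → ∑ i, ⁅q (ξ i), q (η i)⁆ = 0 := by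
    intro n ξ η χ h
    have h1 := sum_lie_eq_altBracket b p (fun l => ξ l ∘ₗ T.σ) (fun l => η l ∘ₗ T.σ)
    have h2 : (fun i j => ∑ l, ((ξ l ∘ₗ T.σ) (b i) * (η l ∘ₗ T.σ) (b j) -
        (ξ l ∘ₗ T.σ) (b j) * (η l ∘ₗ T.σ) (b i))) =
        fun i j => χ (mulBilin 𝒜 (T.σ (b i)) (T.σ (b j))) :=
      funext fun i => funext fun j => h _ _
    rw [h2, T.altBracket_eq_neg_deriv b p hp χ] at h1
    have h3 : T.contr χ = ∑ l, (ξ l T.a • (η l ∘ₗ T.σ) - η l T.a • (ξ l ∘ₗ T.σ)) := by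
      ext u
      rw [contr_apply, ← h]
      simp [mul_comm]
    have h4 : ∀ l, ⁅q (ξ l), q (η l)⁆ = LieAlgebra.SemiDirectSum.inl LieHom.id
        (⁅p (ξ l ∘ₗ T.σ), p (η l ∘ₗ T.σ)⁆ +
          T.deriv b p (ξ l T.a • (η l ∘ₗ T.σ) - η l T.a • (ξ l ∘ₗ T.σ))) := by
      intro l
      have h5 : ∀ w, D (p w) = T.deriv b p w := hD
      refine LieAlgebra.SemiDirectSum.ext ?_ ?_
      · change ⁅p (ξ l ∘ₗ T.σ), p (η l ∘ₗ T.σ)⁆ + (ξ l T.a • D) (p (η l ∘ₗ T.σ)) -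
          (η l T.a • D) (p (ξ l ∘ₗ T.σ)) = ⁅p (ξ l ∘ₗ T.σ), p (η l ∘ₗ T.σ)⁆ +
          T.deriv b p (ξ l T.a • (η l ∘ₗ T.σ) - η l T.a • (ξ l ∘ₗ T.σ))
        rw [LieDerivation.smul_apply, LieDerivation.smul_apply, h5, h5, map_sub, map_smul,
          map_smul, add_sub_assoc]
      · change ⁅ξ l T.a • D, η l T.a • D⁆ = 0
        ext z
        simp
    simp_rw [h4]
    rw [← map_sum, Finset.sum_add_distrib, h1, ← map_sum, ← h3, neg_add_cancel, map_zero]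
  have hcomp : (holoLift q hq).comp T.holoMap =
      (LieAlgebra.SemiDirectSum.inl LieHom.id).comp P := holo_hom_ext fun w => by
    rw [LieHom.comp_apply, LieHom.comp_apply, holoMap_holoOf, holoLift_holoOf]
    have hw : (w ∘ₗ T.π₁) ∘ₗ T.σ = w := by ext u; simp [T.π₁_σ]
    have hw' : (w ∘ₗ T.π₁) T.a = 0 := by simp [T.π₁_a]
    change (⟨p ((w ∘ₗ T.π₁) ∘ₗ T.σ), (w ∘ₗ T.π₁) T.a • D⟩ : G) = _
    rw [hw, hw', zero_smul]
    rfl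
  have h := LieHom.congr_fun hcomp x
  rw [LieHom.comp_apply, hx, map_zero, LieHom.comp_apply] at h
  exact congrArg LieAlgebra.SemiDirectSum.left h.symm

theorem mem_of_holoMap_eq_zero (J : LieIdeal k (Holo k B ℬ))
    (hC : ∀ φ : Module.Dual k (ℬ 2), ∑ i, ∑ j, φ (mulBilin ℬ (b i) (b j)) •
      ⁅quotMk J (holoOf ℬ (b.coord i)),
        T.deriv b ((quotMk J : Holo k B ℬ →ₗ[k] Holo k B ℬ ⧸ J) ∘ₗ holoOf ℬ) (b.coord j)⁆ = 0)
    (hJ : ∀ D : Holo k B ℬ →ₗ[k] Holo k B ℬ ⧸ J,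
      (∀ x y, D ⁅x, y⁆ = ⁅D x, quotMk J y⁆ + ⁅quotMk J x, D y⁆) →
      (∀ w, D (holoOf ℬ w) ∈
        LieModule.lowerCentralSeries k (Holo k B ℬ ⧸ J) (Holo k B ℬ ⧸ J) 1) → ∀ x ∈ J, D x = 0)
    {x : Holo k B ℬ} (hx : T.holoMap x = 0) : x ∈ J := by
  let p : Module.Dual k (ℬ 1) →ₗ[k] Holo k B ℬ ⧸ J :=
    (quotMk J : Holo k B ℬ →ₗ[k] Holo k B ℬ ⧸ J) ∘ₗ holoOf ℬ
  obtain ⟨D, hD, hD'⟩ := exists_derivation (quotMk J) (T.deriv b p) fun n ξ η φ h => by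
    refine (sum_lie_add_lie_eq b p (T.deriv b p) ξ η).trans (Eq.trans ?_ (hC φ))
    exact Finset.sum_congr rfl fun i _ => Finset.sum_congr rfl fun j _ => by rw [h]; rfl
  have hDJ := hJ D hD' fun w => by rw [hD]; exact T.deriv_mem_lcs b p w
  let D' : LieDerivation k (Holo k B ℬ ⧸ J) (Holo k B ℬ ⧸ J) :=
    { toLinearMap := J.toSubmodule.liftQ D hDJ
      leibniz' := fun x y => by
        obtain ⟨x, rfl⟩ := quotMk_surjective J x
        obtain ⟨y, rfl⟩ := quotMk_surjective J y
        rw [← LieHom.map_lie]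
        change D ⁅x, y⁆ = ⁅quotMk J x, D y⁆ - ⁅quotMk J y, D x⁆
        rw [hD', ← lie_skew (D x)]
        abel }
  exact quotMk_eq_zero.1 (T.map_eq_zero_of_holoMap_eq_zero b (quotMk J) D' hD hx)

include b in
theorem holoMap_injective
    (hψ : ∀ φ : Module.Dual k (ℬ 2), ∃ ψ : Module.Dual k A, ∀ x : 𝒜 2, ψ (T.a * x) = φ (T.π₂ x))
    {x : Holo k B ℬ} (hx : T.holoMap x = 0) : x = 0 := by
  refine (LieSubmodule.mem_bot x).1 (T.mem_of_holoMap_eq_zero b ⊥ (fun φ => ?_)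
    (fun D _ _ y hy => ?_) hx)
  · obtain ⟨ψ, hψ⟩ := hψ φ
    refine T.sum_lie_deriv_eq_zero b _ (fun φ => ?_) φ ψ hψ
    exact T.altBracket_map_holoOf_eq_zero b (quotMk ⊥) φ
  · rw [(LieSubmodule.mem_bot y).1 hy, map_zero]

include b in
theorem mem_lcs_two_of_holoMap_eq_zero {x : Holo k B ℬ} (hx : T.holoMap x = 0) :
    x ∈ LieModule.lowerCentralSeries k (Holo k B ℬ) (Holo k B ℬ) 2 := by
  let J : LieIdeal k (Holo k B ℬ) := LieModule.lowerCentralSeries k (Holo k B ℬ) (Holo k B ℬ) 2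
  have hN : ∀ u v, v ∈ LieModule.lowerCentralSeries k (Holo k B ℬ ⧸ J) (Holo k B ℬ ⧸ J) 1 →
      ⁅u, v⁆ = 0 := fun u v hv => by
    obtain ⟨y, hy, h⟩ := (map_lcs_eq_of_surjective _ (quotMk_surjective J) 2).ge
      (lie_mem_lcs_succ u hv)
    rw [← h]
    exact quotMk_eq_zero.2 hy
  refine T.mem_of_holoMap_eq_zero b J (fun φ => ?_) (fun D hD hD' y hy => ?_) hx
  · refine Finset.sum_eq_zero fun i _ => Finset.sum_eq_zero fun j _ => ?_
    rw [hN _ _ (T.deriv_mem_lcs b _ _), smul_zero]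
  · let S : Submodule k (Holo k B ℬ) :=
      (LieModule.lowerCentralSeries k (Holo k B ℬ ⧸ J) (Holo k B ℬ ⧸ J) 1).toSubmodule.comap D
    have hlie : ∀ {x y : Holo k B ℬ}, x ∈ S → y ∈ S → ⁅x, y⁆ ∈ S := by
      intro x y _ _
      change D _ ∈ LieModule.lowerCentralSeries k (Holo k B ℬ ⧸ J) (Holo k B ℬ ⧸ J) 1
      rw [hD]
      exact add_mem (lie_mem_lcs_one _ _) (lie_mem_lcs_one _ _)
    have hS : ∀ x, D x ∈ LieModule.lowerCentralSeries k (Holo k B ℬ ⧸ J) (Holo k B ℬ ⧸ J) 1 :=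
      holo_induction S hlie hD'
    refine lcs_succ_le (n := 1) (S := LinearMap.ker D) (fun u v _ => ?_) hy
    rw [LinearMap.mem_ker, hD, hN _ _ (hS v), add_zero, ← lie_skew, hN _ _ (hS u), neg_zero]

end TransferData

end Transfer

section Construction

variable {k A B : Type} [Field k] [Ring A] [Algebra k A] [Ring B] [Algebra k B]

/-- If multiplication by `a` is exact in degree one, the quotient map by `aA` gives rise to the
data of `TransferData`. -/
theorem TransferData.exists_of_quotient (𝒜 : ℕ → Submodule k A) [GradedAlgebra 𝒜]
    (ℬ : ℕ → Submodule k B) [GradedAlgebra ℬ]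
    (hconn : ∀ x ∈ 𝒜 0, ∃ c : k, x = algebraMap k A c)
    (hsq : ∀ x ∈ 𝒜 1, x * x = 0) {a : A} (ha : a ∈ 𝒜 1) (ha0 : a ≠ 0)
    (π : A →ₐ[k] B) (hπgr : ∀ i, (𝒜 i).map π.toLinearMap = ℬ i)
    (hker : ∀ x : A, π x = 0 ↔ ∃ y : A, x = a * y)
    (hres : ∀ x ∈ 𝒜 1, a * x = 0 → π x = 0) :
    ∃ T : TransferData 𝒜 ℬ, (T.a : A) = a ∧ ∀ x, (T.π₂ x : B) = π x := by
  have hmem : ∀ i, ∀ x ∈ 𝒜 i, π x ∈ ℬ i := fun i x hx => hπgr i ▸ ⟨x, hx, rfl⟩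
  have hkerdeg : ∀ i, ∀ x ∈ 𝒜 (1 + i), π x = 0 → ∃ y ∈ 𝒜 i, x = a * y := by
    intro i x hx h
    obtain ⟨y, rfl⟩ := (hker x).1 h
    refine ⟨_, (DirectSum.decompose 𝒜 y i).2, ?_⟩
    rw [← DirectSum.coe_decompose_mul_add_of_left_mem 𝒜 ha, DirectSum.decompose_of_mem_same 𝒜 hx]
  let π₁ : 𝒜 1 →ₗ[k] ℬ 1 := π.toLinearMap.restrict (hmem 1)
  let π₂ : 𝒜 2 →ₗ[k] ℬ 2 := π.toLinearMap.restrict (hmem 2)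
  have hsurj : ∀ u, ∃ x, π₁ x = u := by
    rintro ⟨u, hu⟩
    rw [← hπgr] at hu
    obtain ⟨x, hx, rfl⟩ := hu
    exact ⟨⟨x, hx⟩, rfl⟩
  obtain ⟨σ, hσ⟩ := π₁.exists_rightInverse_of_surjective (LinearMap.range_eq_top.2 hsurj)
  let a₁ : 𝒜 1 := ⟨a, ha⟩
  have hπa : π₁ a₁ = 0 := Subtype.ext ((hker a).2 ⟨1, (mul_one a).symm⟩)
  obtain ⟨t₀, ht₀⟩ := exists_comp_eq_of_ker_le (LinearMap.toSpanSingleton k (𝒜 1) a₁)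
    (LinearMap.id : k →ₗ[k] k) fun c hc => by
      rcases smul_eq_zero.1 (show c • a₁ = 0 from hc) with h | h
      · exact h
      · exact absurd (congrArg Subtype.val h) ha0
  have ht₀' : ∀ c : k, t₀ (c • a₁) = c := ht₀
  obtain ⟨θ, hθ⟩ := exists_comp_eq_of_ker_le (mulBilin 𝒜 a₁) π₁ fun x hx =>
    Subtype.ext (hres x x.2 (congrArg Subtype.val hx))
  have hπσ : ∀ u, π₁ (σ u) = u := LinearMap.congr_fun hσ
  have hmul : ∀ x y, π₂ (mulBilin 𝒜 x y) = mulBilin ℬ (π₁ x) (π₁ y) :=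
    fun x y => Subtype.ext (map_mul π (x : A) y)
  refine ⟨⟨a₁, π₁, π₂, σ, t₀ - t₀ ∘ₗ σ ∘ₗ π₁, θ, fun x => hsq x x.2, hmul, hπa, hπσ, ?_, ?_, ?_, hθ,
    ?_⟩, rfl, fun x => rfl⟩
  · simpa [hπa] using ht₀' 1
  · intro u
    simp [hπσ]
  · intro x
    have h : π₁ (x - σ (π₁ x)) = 0 := by rw [map_sub, hπσ, sub_self]
    obtain ⟨y, hy, hxy⟩ := hkerdeg 0 _ (x - σ (π₁ x)).2 (congrArg Subtype.val h)
    obtain ⟨c, rfl⟩ := hconn y hy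
    have h' : x - σ (π₁ x) = c • a₁ := Subtype.ext <| by
      rw [hxy, Algebra.algebraMap_eq_smul_one, mul_smul_comm, mul_one]; rfl
    have ht : (t₀ - t₀ ∘ₗ σ ∘ₗ π₁) x = c := by
      rw [← ht₀' c, ← h', map_sub]; rfl
    rw [ht, ← h', sub_add_cancel]
  · intro χ hχ
    refine exists_comp_eq_of_ker_le π₂ χ fun x hx => ?_
    obtain ⟨y, hy, hxy⟩ := hkerdeg 1 x x.2 (congrArg Subtype.val hx)
    have hx' : x = mulBilin 𝒜 a₁ ⟨y, hy⟩ := Subtype.ext hxy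
    rw [hx', hχ]

theorem subsingleton_gPiece (𝒜 : ℕ → Submodule k A) [GradedAlgebra 𝒜]
    (h : ∀ x ∈ 𝒜 1, x = 0) (s : ℕ) : Subsingleton (gPiece k A 𝒜 s) := by
  have h1 : ∀ x : Holo k A 𝒜, x = 0 := fun x => by
    refine (Submodule.mem_bot k).1 (holo_induction ⊥ (fun {x y} hx _ => ?_) (fun ξ => ?_) x)
    · rw [(Submodule.mem_bot k).1 hx, zero_lie]
      exact zero_mem _
    · have hξ : ξ = 0 := by
        ext x
        rw [show x = 0 from Subtype.ext (h x x.2), map_zero, map_zero]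
      rw [hξ, map_zero]
      exact zero_mem _
  have : Subsingleton (Holo k A 𝒜) := ⟨fun x y => by rw [h1 x, h1 y]⟩
  have : Subsingleton (GLie k A 𝒜) := (quotMk_surjective _).subsingleton
  have := (Submodule.mkQ_surjective (LieModule.lowerCentralSeries k (GLie k A 𝒜)
    (GLie k A 𝒜) s).toSubmodule).subsingleton
  infer_instance

/-- The metabelian quotients of the holonomy Lie algebras of `A` and `A/aA` agree in degree two,
and in degrees greater than two if multiplication by `a` is exact in degree two. -/
theorem nonempty_gPiece_equiv (𝒜 : ℕ → Submodule k A) [GradedAlgebra 𝒜]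
    (ℬ : ℕ → Submodule k B) [GradedAlgebra ℬ] [FiniteDimensional k (ℬ 1)]
    (T : TransferData 𝒜 ℬ) (n : ℕ)
    (hψ : n ≠ 0 → ∀ φ : Module.Dual k (ℬ 2), ∃ ψ : Module.Dual k A,
      ∀ x : 𝒜 2, ψ (T.a * x) = φ (T.π₂ x)) :
    Nonempty (gPiece k A 𝒜 (n + 2) ≃ₗ[k] gPiece k B ℬ (n + 2)) := by
  let b := Module.finBasis k (ℬ 1)
  obtain ⟨e⟩ : Nonempty (metabelianPiece k (Holo k B ℬ) (n + 1) (n + 2) ≃ₗ[k]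
      metabelianPiece k (Holo k A 𝒜) (n + 1) (n + 2)) := by
    refine nonempty_metabelianPiece_equiv (T.exists_smul_t_add_holoMap b) (T.lie_t_holoMap_mem b) n
      fun x hx => ?_
    rcases eq_or_ne n 0 with rfl | hn
    · exact T.mem_lcs_two_of_holoMap_eq_zero b hx
    · rw [T.holoMap_injective b (hψ hn) hx]
      exact zero_mem _
  exact ⟨e.symm⟩

end Construction

end HolonomyTransfer

/-- Let `A` be a connected, locally finite, graded,
graded-commutative `k`-algebra, generated in degree `1`, with `dim_k A¹ < ∞` and
`a² = 0` for all `a ∈ A¹`.  Let `a ∈ A¹` and `B = A/aA` (presented here by a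
surjective graded algebra map `π : A → B` with kernel `aA`).  If `a` is
non-resonant up to degree `r`, i.e. `a ∉ ⋃_{i=1}^r R^i_1(A)`, then
`g_s(A) ≅ g_s(B)` for all `2 ≤ s ≤ r+1`, where `g(A) = h(A)/h''(A)` is the maximal
metabelian quotient of the holonomy Lie algebra, graded by bracket length. -/
theorem statement18 {k A B : Type} [Field k] [Ring A] [Algebra k A] [Ring B] [Algebra k B]
    (𝒜 : ℕ → Submodule k A) [GradedAlgebra 𝒜]
    (ℬ : ℕ → Submodule k B) [GradedAlgebra ℬ]
    (hconn : ∀ x ∈ 𝒜 0, ∃ c : k, x = algebraMap k A c)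
    (hfin : ∀ i, FiniteDimensional k ↥(𝒜 i))
    (hgc : ∀ (i j : ℕ), ∀ x ∈ 𝒜 i, ∀ y ∈ 𝒜 j, x * y = ((-1 : k) ^ (i * j)) • (y * x))
    (hsq : ∀ x ∈ 𝒜 1, x * x = 0)
    (hgen : Algebra.adjoin k ((𝒜 1 : Submodule k A) : Set A) = ⊤)
    (a : A) (ha : a ∈ 𝒜 1)
    (π : A →ₐ[k] B) (hπsurj : Function.Surjective π)
    (hπgr : ∀ i, (𝒜 i).map π.toLinearMap = ℬ i)
    (hker : ∀ x : A, π x = 0 ↔ ∃ y : A, x = a * y)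
    (r : ℕ) (hr : 1 ≤ r)
    (hres : ∀ i : ℕ, 1 ≤ i → i ≤ r → ∀ x ∈ 𝒜 i, x * a = 0 → ∃ y ∈ 𝒜 (i-1), x = y * a) :
    ∀ s : ℕ, 2 ≤ s → s ≤ r + 1 →
      Nonempty (↥(gPiece k A 𝒜 s) ≃ₗ[k] ↥(gPiece k B ℬ s)) := by
  intro s hs hsr
  have haa : ∀ x ∈ 𝒜 1, a * x = 0 → x * a = 0 := fun x hx h => by
    rw [hgc 1 1 x hx a ha, h, smul_zero]
  have hres1 : ∀ x ∈ 𝒜 1, a * x = 0 → ∃ c : k, x = c • a := fun x hx h => by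
    obtain ⟨y, hy, rfl⟩ := hres 1 le_rfl hr x hx (haa x hx h)
    obtain ⟨c, rfl⟩ := hconn y hy
    exact ⟨c, (Algebra.smul_def c a).symm⟩
  have hπa : π a = 0 := (hker a).2 ⟨1, (mul_one a).symm⟩
  by_cases ha0 : a = 0
  · have hA : ∀ x ∈ 𝒜 1, x = 0 := fun x hx => by
      obtain ⟨c, rfl⟩ := hres1 x hx (by rw [ha0, zero_mul])
      rw [ha0, smul_zero]
    have hB : ∀ x ∈ ℬ 1, x = 0 := fun x hx => by
      rw [← hπgr] at hx
      obtain ⟨y, hy, rfl⟩ := hx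
      rw [hA y hy, map_zero]
    have := HolonomyTransfer.subsingleton_gPiece 𝒜 hA s
    have := HolonomyTransfer.subsingleton_gPiece ℬ hB s
    exact ⟨0⟩
  obtain ⟨T, hTa, hTπ⟩ := HolonomyTransfer.TransferData.exists_of_quotient 𝒜 ℬ hconn hsq ha ha0 π
    hπgr hker fun x hx h => by
      obtain ⟨c, rfl⟩ := hres1 x hx h
      rw [map_smul, hπa, smul_zero]
  have : FiniteDimensional k (ℬ 1) := by
    have := hfin 1
    rw [← hπgr 1]
    infer_instance
  obtain ⟨n, rfl⟩ := Nat.exists_eq_add_of_le' hs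
  refine HolonomyTransfer.nonempty_gPiece_equiv 𝒜 ℬ T n fun hn φ => ?_
  obtain ⟨ψ, hψ⟩ := HolonomyTransfer.exists_comp_eq_of_ker_le
    (LinearMap.mulLeft k a ∘ₗ (𝒜 2).subtype) (φ ∘ₗ T.π₂) fun x hx => by
      have hxa : (x : A) * a = 0 := by
        rw [hgc 2 1 x x.2 a ha, show a * (x : A) = 0 from hx, smul_zero]
      obtain ⟨y, hy, hxy⟩ := hres 2 (by omega) (by omega) x x.2 hxa
      have h : T.π₂ x = 0 := Subtype.ext <| by
        rw [hTπ, hxy, map_mul, hπa, mul_zero]; rfl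
      rw [LinearMap.comp_apply, h, map_zero]
  exact ⟨ψ, fun x => by rw [hTa]; exact hψ x⟩
end
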